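/- Let n ≥ 2 and let f : S^n → (0,∞) be a positive Lipschitz function, extended to ℝ^{n+1}\{0} as a function homogeneous of degree −1. Then there exists a convex function u : ℝ^{n+1} → ℝ that is homogeneous of degree 1, of class C² on ℝ^{n+1}\{0}, and satisfies Δu = f on ℝ^{n+1}\{0}, if and only if both of the following hold: (i) ∫_{S^n} x_i f(x) dσ(x) = 0 for every coordinate i = 1, …, n+1, and (ii) for every x ∈ S^n and every unit vector ξ with ⟨ξ, x⟩ = 0, ∫_{ℝ^{n+1}} ( −⟨ξ, y⟩ · ⟨∇f(y), ξ⟩ ) / |x − y|^{n+1} dy ≥ 0. Moreover, any two such convex solutions differ by a linear function x ↦ ⟨a, x⟩ for some fixed a ∈ ℝ^{n+1}. -/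

import Mathlib

open MeasureTheory Metric Set
open scoped RealInnerProductSpace

/-- The Euclidean Laplacian of `u : ℝ^m → ℝ`, as the sum of second partial
derivatives along the standard coordinate directions. -/
noncomputable def laplacian {m : ℕ} (u : EuclideanSpace ℝ (Fin m) → ℝ)
    (x : EuclideanSpace ℝ (Fin m)) : ℝ :=
  ∑ i, fderiv ℝ (fun y => fderiv ℝ u y (EuclideanSpace.single i 1)) x (EuclideanSpace.single i 1)

/-- The surface measure on the unit sphere `Sⁿ ⊂ ℝ^{n+1}`. -/
noncomputable def sphereMeasure (n : ℕ) :
    Measure (sphere (0 : EuclideanSpace ℝ (Fin (n + 1))) 1) :=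
  (volume : Measure (EuclideanSpace ℝ (Fin (n + 1)))).toSphere

/-- `u` is a solution of the Christoffel problem with data `f`: it is continuous,
convex, positively homogeneous of degree one, `C²` away from the origin, and solves
`Δu = f` away from the origin. -/
def IsChristoffelSolution (n : ℕ) (f u : EuclideanSpace ℝ (Fin (n + 1)) → ℝ) : Prop :=
  Continuous u ∧ ConvexOn ℝ Set.univ u ∧
  (∀ t : ℝ, 0 < t → ∀ y : EuclideanSpace ℝ (Fin (n + 1)), y ≠ 0 → u (t • y) = t * u y) ∧
  ContDiffOn ℝ 2 u {(0 : EuclideanSpace ℝ (Fin (n + 1)))}ᶜ ∧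
  (∀ x : EuclideanSpace ℝ (Fin (n + 1)), x ≠ 0 → laplacian u x = f x)

open Filter Topology

/-- The Euclidean space `ℝ^{n+1}`. -/
abbrev Euc (n : ℕ) := EuclideanSpace ℝ (Fin (n + 1))

/-- An integrable majorant on `ℝ^{n+1}`, singular of order `n` at the origin. -/
noncomputable def majorant (n : ℕ) (z : Euc n) : ℝ := (‖z‖ ^ n * (1 + ‖z‖) ^ 2)⁻¹

theorem majorant_nonneg (n : ℕ) (z : Euc n) : 0 ≤ majorant n z := by
  unfold majorant; positivity

theorem integrable_majorant (n : ℕ) : Integrable (majorant n) := by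
  have h := integrable_fun_norm_addHaar (volume : Measure (Euc n))
    (f := fun r => (r ^ n * (1 + r) ^ 2)⁻¹)
  refine h.2 ?_
  have h2 : IntegrableOn (fun r : ℝ => (r + 1) ^ (-2 : ℝ)) (Ioi 0) :=
    integrableOn_add_rpow_Ioi_of_lt (by norm_num) (by norm_num)
  refine h2.congr_fun (fun r hr => ?_) measurableSet_Ioi
  have hr : 0 < r := hr
  simp only [finrank_euclideanSpace, Fintype.card_fin, Nat.add_sub_cancel, smul_eq_mul]
  rw [Real.rpow_neg (by positivity)]
  have : (r + 1) ^ (2 : ℝ) = (r + 1) ^ 2 := by exact_mod_cast Real.rpow_natCast _ 2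
  rw [this]
  field_simp
  ring

theorem integrable_majorant_sub (n : ℕ) (x : Euc n) :
    Integrable (fun y => majorant n (x - y)) :=
  (integrable_majorant n).comp_sub_left x

theorem ae_ne_zero (n : ℕ) : ∀ᵐ y : Euc n, y ≠ 0 := by
  have : (volume : Measure (Euc n)) {0} = 0 := measure_singleton 0
  exact compl_mem_ae_iff.2 this

theorem restrict_compl_zero (n : ℕ) :
    (volume : Measure (Euc n)).restrict {0}ᶜ = volume :=
  Measure.restrict_eq_self_of_ae_mem (ae_ne_zero n)

theorem aestronglyMeasurable_of_continuousOn_compl {n : ℕ} {F : Type*} [NormedAddCommGroup F]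
    {g : Euc n → F} (hg : ContinuousOn g {0}ᶜ) : AEStronglyMeasurable g volume := by
  have h := hg.aestronglyMeasurable_of_isSeparable (μ := volume)
    (measurableSet_singleton (0 : Euc n)).compl (TopologicalSpace.IsSeparable.of_separableSpace _)
  rwa [restrict_compl_zero] at h

/-- Integration in polar coordinates of a product of an angular and a radial function. -/
theorem integral_polar_mul {n : ℕ} (A : sphere (0 : Euc n) 1 → ℝ) (B : ℝ → ℝ)
    (h : Euc n → ℝ) (hh : ∀ (ω : sphere (0 : Euc n) 1) (r : ℝ), 0 < r →
      h (r • (ω : Euc n)) = A ω * B r) :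
    ∫ y, h y = (∫ ω, A ω ∂(sphereMeasure n)) *
      ∫ r : Ioi (0 : ℝ), B r ∂(Measure.volumeIoiPow n) := by
  have e1 : ∫ y, h y = ∫ y in ({0}ᶜ : Set (Euc n)), h y := by
    rw [restrict_compl_zero]
  have e2 : ∫ y in ({0}ᶜ : Set (Euc n)), h y =
      ∫ y : ({0}ᶜ : Set (Euc n)), h y ∂((volume : Measure (Euc n)).comap (↑)) := by
    rw [integral_subtype_comap (measurableSet_singleton _).compl]
  have mp := (volume : Measure (Euc n)).measurePreserving_homeomorphUnitSphereProd
  have e3 := mp.integral_comp (homeomorphUnitSphereProd (Euc n)).measurableEmbedding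
    (fun p => A p.1 * B p.2)
  rw [e1, e2]
  have hdim : Module.finrank ℝ (Euc n) - 1 = n := by simp
  rw [hdim] at e3
  have : IsFiniteMeasure (sphereMeasure n) := by unfold sphereMeasure; infer_instance
  rw [← integral_prod_mul (μ := sphereMeasure n) (ν := Measure.volumeIoiPow n) A
    (fun r : Ioi (0 : ℝ) => B r)]
  unfold sphereMeasure
  rw [← e3]
  congr 1
  ext y
  have hy : (y : Euc n) ≠ 0 := y.2
  rw [← hh _ _ (Subtype.mem (homeomorphUnitSphereProd (Euc n) y).2)]
  congr 1
  simp [smul_smul, norm_ne_zero_iff.2 hy]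

/-- Integration by parts for a function which is locally Lipschitz away from the origin against
a `C¹` function with compact support avoiding the origin. -/
theorem integral_fderiv_mul_eq_neg {n : ℕ} {h φ : Euc n → ℝ}
    (hh : LocallyLipschitzOn {0}ᶜ h) (hφ : ContDiff ℝ 1 φ) (hc : HasCompactSupport φ)
    (h0 : (0 : Euc n) ∉ tsupport φ) (v : Euc n) :
    ∫ y, fderiv ℝ h y v * φ y = -∫ y, h y * fderiv ℝ φ y v := by
  have hK : IsCompact (tsupport φ) := hc
  obtain ⟨δ, hδ, hsub⟩ := hK.exists_cthickening_subset_open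
    (isOpen_compl_singleton (x := (0 : Euc n)))
    (by intro y hy; rintro rfl; exact h0 hy)
  have hK' : IsCompact (cthickening δ (tsupport φ)) := hK.cthickening
  obtain ⟨C, hC⟩ := LocallyLipschitzOn.exists_lipschitzOnWith_of_compact hK' (hh.mono hsub)
  obtain ⟨g, hg, hgh⟩ := hC.extend_real
  obtain ⟨D, hD⟩ := ContDiff.lipschitzWith_of_hasCompactSupport hc hφ (by simp)
  have key := LipschitzWith.integral_lineDeriv_mul_eq (μ := volume) hg hD hc v
  have e1 : ∫ y, fderiv ℝ h y v * φ y = ∫ y, lineDeriv ℝ g y v * φ y := by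
    refine integral_congr_ae ?_
    filter_upwards [hg.ae_differentiableAt (μ := volume)] with y hy
    by_cases hyK : y ∈ tsupport φ
    · have hev : h =ᶠ[𝓝 y] g := by
        have : cthickening δ (tsupport φ) ∈ 𝓝 y :=
          mem_of_superset (isOpen_thickening.mem_nhds (self_subset_thickening hδ _ hyK))
            (thickening_subset_cthickening _ _)
        filter_upwards [this] with z hz using hgh hz
      rw [hy.lineDeriv_eq_fderiv, hev.fderiv_eq]
    · simp [image_eq_zero_of_notMem_tsupport hyK]
  have e2 : ∫ y, lineDeriv ℝ φ y (-v) * g y = -∫ y, h y * fderiv ℝ φ y v := by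
    rw [← integral_neg]
    refine integral_congr_ae (Eventually.of_forall fun y => ?_)
    have hd : DifferentiableAt ℝ φ y := hφ.differentiable (by simp) y
    simp only
    rw [hd.lineDeriv_eq_fderiv, map_neg]
    by_cases hyK : y ∈ tsupport φ
    · rw [hgh (self_subset_cthickening _ hyK)]; ring
    · have : fderiv ℝ φ y = 0 := by
        by_contra hne
        exact hyK (support_fderiv_subset ℝ (f := φ) (Function.mem_support.2 hne))
      simp [this]
  rw [e1, key, e2]

/-- A fixed smooth bump function on the line. -/
noncomputable def lineBump : ContDiffBump (0 : ℝ) := ⟨1, 2, by norm_num, by norm_num⟩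

/-- Profile of a radial cutoff, as a function of the square of the radius. -/
noncomputable def cutoffProfile (j : ℕ) (s : ℝ) : ℝ :=
  lineBump (s / (j + 4)) * (1 - lineBump ((j + 4) * s))

/-- A radial cutoff vanishing near the origin and near infinity. -/
noncomputable def radialCutoff (n j : ℕ) (y : Euc n) : ℝ := cutoffProfile j (‖y‖ ^ 2)

theorem contDiff_cutoffProfile (j : ℕ) {m : ℕ∞} : ContDiff ℝ m (cutoffProfile j) := by
  have h : ContDiff ℝ m lineBump := lineBump.contDiff
  unfold cutoffProfile
  exact (h.comp (by fun_prop)).mul (contDiff_const.sub (h.comp (by fun_prop)))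

theorem contDiff_radialCutoff (n j : ℕ) : ContDiff ℝ 1 (radialCutoff n j) :=
  (contDiff_cutoffProfile j (m := 1)).comp (contDiff_norm_sq ℝ)

theorem cutoffProfile_nonneg (j : ℕ) (s : ℝ) : 0 ≤ cutoffProfile j s :=
  mul_nonneg lineBump.nonneg (sub_nonneg.2 lineBump.le_one)

theorem cutoffProfile_le_one (j : ℕ) (s : ℝ) : cutoffProfile j s ≤ 1 :=
  mul_le_one₀ lineBump.le_one (sub_nonneg.2 lineBump.le_one)
    (by linarith [lineBump.nonneg (x := ((j : ℝ) + 4) * s)])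

theorem cutoffProfile_one (j : ℕ) : cutoffProfile j 1 = 1 := by
  unfold cutoffProfile
  have h1 : lineBump (1 / ((j : ℝ) + 4)) = 1 := by
    apply lineBump.one_of_mem_closedBall
    simp only [mem_closedBall, dist_zero_right, Real.norm_eq_abs, lineBump]
    rw [abs_of_nonneg (by positivity), div_le_one (by positivity)]
    have : (0 : ℝ) ≤ j := by positivity
    linarith
  have h2 : lineBump (((j : ℝ) + 4) * 1) = 0 := by
    apply lineBump.zero_of_le_dist
    simp only [dist_zero_right, Real.norm_eq_abs, lineBump]
    rw [abs_of_nonneg (by positivity)]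
    have : (0 : ℝ) ≤ j := by positivity
    linarith
  rw [h1, h2]; norm_num

theorem radialCutoff_support (n j : ℕ) {y : Euc n} (hy : radialCutoff n j y ≠ 0) :
    1 / ((j : ℝ) + 4) ≤ ‖y‖ ^ 2 ∧ ‖y‖ ^ 2 ≤ 2 * (j + 4) := by
  have hj : (0 : ℝ) < j + 4 := by positivity
  constructor
  · by_contra! h
    apply hy
    have : lineBump (((j : ℝ) + 4) * ‖y‖ ^ 2) = 1 := by
      apply lineBump.one_of_mem_closedBall
      simp only [mem_closedBall, dist_zero_right, Real.norm_eq_abs, lineBump]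
      rw [abs_of_nonneg (by positivity)]
      rw [lt_div_iff₀ hj] at h
      linarith
    simp [radialCutoff, cutoffProfile, this]
  · by_contra! h
    apply hy
    have : lineBump (‖y‖ ^ 2 / ((j : ℝ) + 4)) = 0 := by
      apply lineBump.zero_of_le_dist
      simp only [dist_zero_right, Real.norm_eq_abs, lineBump]
      rw [abs_of_nonneg (by positivity), le_div_iff₀ hj]
      exact h.le
    simp [radialCutoff, cutoffProfile, this]

theorem hasCompactSupport_radialCutoff (n j : ℕ) : HasCompactSupport (radialCutoff n j) := by
  apply HasCompactSupport.of_support_subset_isCompact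
    (isCompact_closedBall (0 : Euc n) (2 * (j + 4)))
  intro y hy
  have h := (radialCutoff_support n j hy).2
  simp only [mem_closedBall, dist_zero_right]
  have hj : (0 : ℝ) ≤ j := by positivity
  nlinarith [norm_nonneg y]

theorem zero_notMem_tsupport_radialCutoff (n j : ℕ) :
    (0 : Euc n) ∉ tsupport (radialCutoff n j) := by
  have hsub : tsupport (radialCutoff n j) ⊆ {y : Euc n | 1 / ((j : ℝ) + 4) ≤ ‖y‖ ^ 2} :=
    closure_minimal (fun y hy => (radialCutoff_support n j hy).1)
      (isClosed_le continuous_const (by fun_prop))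
  intro h
  have := hsub h
  simp only [mem_ofPred_eq, norm_zero] at this
  have hj : (0 : ℝ) < 1 / (j + 4) := by positivity
  norm_num at this
  linarith [show (0:ℝ) ≤ j by positivity]

theorem fderiv_radialCutoff (n j : ℕ) (y v : Euc n) :
    fderiv ℝ (radialCutoff n j) y v = deriv (cutoffProfile j) (‖y‖ ^ 2) * (2 * ⟪y, v⟫) := by
  have h1 : HasDerivAt (cutoffProfile j) (deriv (cutoffProfile j) (‖y‖ ^ 2)) (‖y‖ ^ 2) :=
    ((contDiff_cutoffProfile j (m := 1)).differentiable (by simp) _).hasDerivAt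
  have h2 := (hasStrictFDerivAt_norm_sq y).hasFDerivAt
  have h3 := h1.comp_hasFDerivAt y h2
  have : fderiv ℝ (radialCutoff n j) y = _ := h3.fderiv
  rw [this]
  simp

theorem mul_deriv_cutoffProfile (j : ℕ) (s : ℝ) : s * deriv (cutoffProfile j) s =
    (s / (j + 4) * deriv lineBump (s / (j + 4))) * (1 - lineBump ((j + 4) * s)) -
      lineBump (s / (j + 4)) * (((j + 4) * s) * deriv lineBump ((j + 4) * s)) := by
  have hd (t : ℝ) : HasDerivAt lineBump (deriv lineBump t) t :=
    ((lineBump.contDiff (n := 1)).differentiable (by simp) t).hasDerivAt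
  have h1 : HasDerivAt (fun s : ℝ => s / ((j : ℝ) + 4)) (1 / ((j : ℝ) + 4)) s :=
    (hasDerivAt_id s).div_const _
  have h2 : HasDerivAt (fun s : ℝ => ((j : ℝ) + 4) * s) (((j : ℝ) + 4) * 1) s :=
    (hasDerivAt_id s).const_mul _
  have h3 : HasDerivAt (cutoffProfile j) _ s :=
    ((hd _).comp s h1).mul (((hd _).comp s h2).const_sub 1)
  rw [h3.deriv]
  simp only [Function.comp]
  ring

theorem exists_bound_mul_deriv_lineBump :
    ∃ M : ℝ, 0 ≤ M ∧ ∀ s, |s * deriv lineBump s| ≤ M := by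
  have hc : Continuous (deriv lineBump) := (lineBump.contDiff (n := 1)).continuous_deriv (by simp)
  have hs : HasCompactSupport (fun s => s * deriv lineBump s) :=
    lineBump.hasCompactSupport.deriv.mul_left
  obtain ⟨M, hM⟩ := hs.exists_bound_of_continuous (by fun_prop)
  exact ⟨M, (norm_nonneg _).trans (hM 0), hM⟩

theorem exists_bound_fderiv_radialCutoff (n : ℕ) : ∃ M : ℝ, 0 ≤ M ∧ ∀ (j : ℕ) (y v : Euc n),
    |fderiv ℝ (radialCutoff n j) y v| ≤ M * (‖v‖ * ‖y‖⁻¹) := by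
  obtain ⟨M, hM0, hM⟩ := exists_bound_mul_deriv_lineBump
  refine ⟨4 * M, by positivity, fun j y v => ?_⟩
  rcases eq_or_ne y 0 with rfl | hy
  · simp [fderiv_radialCutoff]
  have hy' : 0 < ‖y‖ := norm_pos_iff.2 hy
  have hb : |‖y‖ ^ 2 * deriv (cutoffProfile j) (‖y‖ ^ 2)| ≤ 2 * M := by
    rw [mul_deriv_cutoffProfile]
    set a := ‖y‖ ^ 2 / ((j : ℝ) + 4) * deriv lineBump (‖y‖ ^ 2 / ((j : ℝ) + 4))
    set b := (((j : ℝ) + 4) * ‖y‖ ^ 2) * deriv lineBump (((j : ℝ) + 4) * ‖y‖ ^ 2)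
    have ha : |a| ≤ M := hM _
    have hb : |b| ≤ M := hM _
    have hc : |1 - lineBump (((j : ℝ) + 4) * ‖y‖ ^ 2)| ≤ 1 := by
      rw [abs_of_nonneg (sub_nonneg.2 lineBump.le_one)]
      linarith [lineBump.nonneg (x := ((j : ℝ) + 4) * ‖y‖ ^ 2)]
    have hd : |lineBump (‖y‖ ^ 2 / ((j : ℝ) + 4))| ≤ 1 := by
      rw [abs_of_nonneg lineBump.nonneg]; exact lineBump.le_one
    refine (abs_sub _ _).trans ?_
    rw [abs_mul a, abs_mul _ b]
    nlinarith [mul_le_mul ha hc (abs_nonneg _) hM0, mul_le_mul hd hb (abs_nonneg _) zero_le_one]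
  rw [fderiv_radialCutoff, abs_mul, abs_mul]
  have hi : |⟪y, v⟫| ≤ ‖y‖ * ‖v‖ := abs_real_inner_le_norm y v
  rw [abs_mul, abs_of_nonneg (by positivity : (0 : ℝ) ≤ ‖y‖ ^ 2)] at hb
  have : |deriv (cutoffProfile j) (‖y‖ ^ 2)| ≤ 2 * M / ‖y‖ ^ 2 := by
    rw [le_div_iff₀ (by positivity)]; linarith
  calc |deriv (cutoffProfile j) (‖y‖ ^ 2)| * (|2| * |⟪y, v⟫|)
      ≤ 2 * M / ‖y‖ ^ 2 * (2 * (‖y‖ * ‖v‖)) := by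
        gcongr; norm_num
    _ = 4 * M * (‖v‖ * ‖y‖⁻¹) := by field_simp; ring

theorem tendsto_mul_nat_add_atTop {s : ℝ} (hs : 0 < s) :
    Tendsto (fun j : ℕ => ((j : ℝ) + 4) * s) atTop atTop :=
  (tendsto_atTop_add_const_right _ _ tendsto_natCast_atTop_atTop).atTop_mul_const hs

theorem tendsto_div_nat_add_zero (s : ℝ) :
    Tendsto (fun j : ℕ => s / ((j : ℝ) + 4)) atTop (𝓝 0) :=
  tendsto_const_nhds.div_atTop (tendsto_atTop_add_const_right _ _ tendsto_natCast_atTop_atTop)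

theorem tendsto_lineBump_atTop : Tendsto lineBump atTop (𝓝 0) := by
  refine tendsto_const_nhds.congr' ?_
  filter_upwards [eventually_ge_atTop 2] with s hs
  symm
  apply lineBump.zero_of_le_dist
  simp only [dist_zero_right, Real.norm_eq_abs, lineBump]
  exact hs.trans (le_abs_self s)

theorem tendsto_mul_deriv_lineBump_atTop :
    Tendsto (fun s => s * deriv lineBump s) atTop (𝓝 0) := by
  refine tendsto_const_nhds.congr' ?_
  filter_upwards [eventually_gt_atTop 2] with s hs
  have : deriv lineBump s = 0 := by
    have hev : lineBump =ᶠ[𝓝 s] fun _ => (0 : ℝ) := by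
      filter_upwards [lt_mem_nhds hs] with t ht
      apply lineBump.zero_of_le_dist
      simp only [dist_zero_right, Real.norm_eq_abs, lineBump]
      exact ht.le.trans (le_abs_self t)
    rw [hev.deriv_eq]; simp
  simp [this]

theorem tendsto_radialCutoff (n : ℕ) {y : Euc n} (hy : y ≠ 0) :
    Tendsto (fun j => radialCutoff n j y) atTop (𝓝 1) := by
  have hs : 0 < ‖y‖ ^ 2 := by positivity
  have h1 : Tendsto (fun j : ℕ => lineBump (‖y‖ ^ 2 / ((j : ℝ) + 4))) atTop (𝓝 1) := by
    have := (lineBump.continuous.tendsto 0).comp (tendsto_div_nat_add_zero (‖y‖ ^ 2))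
    rwa [lineBump.one_of_mem_closedBall (by simp [lineBump])] at this
  have h2 := tendsto_lineBump_atTop.comp (tendsto_mul_nat_add_atTop hs)
  have := h1.mul (h2.const_sub 1)
  simpa [radialCutoff, cutoffProfile, Function.comp_def] using this

theorem tendsto_fderiv_radialCutoff (n : ℕ) {y : Euc n} (hy : y ≠ 0) (v : Euc n) :
    Tendsto (fun j => fderiv ℝ (radialCutoff n j) y v) atTop (𝓝 0) := by
  have hs : 0 < ‖y‖ ^ 2 := by positivity
  have h1 : Tendsto (fun j : ℕ => lineBump (‖y‖ ^ 2 / ((j : ℝ) + 4))) atTop (𝓝 1) := by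
    have := (lineBump.continuous.tendsto 0).comp (tendsto_div_nat_add_zero (‖y‖ ^ 2))
    rwa [lineBump.one_of_mem_closedBall (by simp [lineBump])] at this
  have h2 := tendsto_lineBump_atTop.comp (tendsto_mul_nat_add_atTop hs)
  have h3 := tendsto_mul_deriv_lineBump_atTop.comp (tendsto_mul_nat_add_atTop hs)
  have hc : Continuous (fun s => s * deriv lineBump s) :=
    continuous_id.mul ((lineBump.contDiff (n := 1)).continuous_deriv (by simp))
  have h4 := (hc.tendsto 0).comp (tendsto_div_nat_add_zero (‖y‖ ^ 2))
  have h5 := (h4.mul (h2.const_sub 1)).sub (h1.mul h3)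
  have h6 := h5.mul_const ((‖y‖ ^ 2)⁻¹ * (2 * ⟪y, v⟫))
  simp only [zero_mul, sub_zero, mul_one, mul_zero] at h6
  refine h6.congr fun j => ?_
  have := mul_deriv_cutoffProfile j (‖y‖ ^ 2)
  simp only [Function.comp]
  rw [← this, fderiv_radialCutoff]
  field_simp

theorem integrable_mul_fderiv_of_compact {n : ℕ} {h φ : Euc n → ℝ}
    (hh : ContinuousOn h {0}ᶜ) (hφ : ContDiff ℝ 1 φ) (hc : HasCompactSupport φ)
    (h0 : (0 : Euc n) ∉ tsupport φ) (v : Euc n) :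
    Integrable (fun y => h y * fderiv ℝ φ y v) := by
  have hsupp : Function.support (fun y => h y * fderiv ℝ φ y v) ⊆ tsupport φ := by
    intro y hy
    have : fderiv ℝ φ y ≠ 0 := by
      intro h1; apply hy; simp [h1]
    exact support_fderiv_subset ℝ (f := φ) (Function.mem_support.2 this)
  rw [← integrableOn_iff_integrable_of_support_subset hsupp]
  refine ContinuousOn.integrableOn_compact hc (ContinuousOn.mul (hh.mono ?_) ?_)
  · intro y hy; rintro rfl; exact h0 hy
  · exact ((hφ.continuous_fderiv (by simp)).clm_apply continuous_const).continuousOn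

/-- Integration by parts on the whole space under decay conditions, for a function which is
locally Lipschitz away from the origin. -/
theorem integral_fderiv_mul_eq_neg_of_le {n : ℕ} {h g : Euc n → ℝ}
    (hh : LocallyLipschitzOn {0}ᶜ h) (hg : ContDiff ℝ 1 g) (v : Euc n) {C : ℝ}
    (h1 : ∀ y ≠ 0, |fderiv ℝ h y v * g y| ≤ C * majorant n y)
    (h2 : ∀ y ≠ 0, |h y * fderiv ℝ g y v| ≤ C * majorant n y)
    (h3 : ∀ y ≠ 0, |h y * g y| * ‖y‖⁻¹ ≤ C * majorant n y) :
    ∫ y, fderiv ℝ h y v * g y = -∫ y, h y * fderiv ℝ g y v := by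
  obtain ⟨M, hM0, hM⟩ := exists_bound_fderiv_radialCutoff n
  have mh : AEStronglyMeasurable h volume :=
    aestronglyMeasurable_of_continuousOn_compl hh.continuousOn
  have mg : AEStronglyMeasurable g volume := hg.continuous.aestronglyMeasurable
  have mh' : AEStronglyMeasurable (fun y => fderiv ℝ h y v) volume :=
    (measurable_fderiv_apply_const ℝ h v).aestronglyMeasurable
  have mg' : AEStronglyMeasurable (fun y => fderiv ℝ g y v) volume :=
    (measurable_fderiv_apply_const ℝ g v).aestronglyMeasurable
  have mχ (j) : AEStronglyMeasurable (radialCutoff n j) volume :=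
    (contDiff_radialCutoff n j).continuous.aestronglyMeasurable
  have mχ' (j) : AEStronglyMeasurable (fun y => fderiv ℝ (radialCutoff n j) y v) volume :=
    (measurable_fderiv_apply_const ℝ _ v).aestronglyMeasurable
  have hχ (j : ℕ) (y : Euc n) : |radialCutoff n j y| ≤ 1 := by
    unfold radialCutoff
    rw [abs_of_nonneg (cutoffProfile_nonneg _ _)]; exact cutoffProfile_le_one _ _
  have step (j : ℕ) : ∫ y, fderiv ℝ h y v * g y * radialCutoff n j y =
      -∫ y, (h y * fderiv ℝ g y v * radialCutoff n j y +
        h y * g y * fderiv ℝ (radialCutoff n j) y v) := by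
    have hd := contDiff_radialCutoff n j
    have := integral_fderiv_mul_eq_neg (φ := fun y => g y * radialCutoff n j y) hh (hg.mul hd)
      (hasCompactSupport_radialCutoff n j).mul_left
      (fun h0 => zero_notMem_tsupport_radialCutoff n j (tsupport_mul_subset_right h0)) v
    simp_rw [mul_assoc]
    rw [this]
    congr 2
    ext y
    rw [fderiv_fun_mul (hg.differentiable (by simp) y) (hd.differentiable (by simp) y)]
    simp only [add_apply, smul_apply, smul_eq_mul]
    ring
  have t1 : Tendsto (fun j => ∫ y, fderiv ℝ h y v * g y * radialCutoff n j y) atTop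
      (𝓝 (∫ y, fderiv ℝ h y v * g y)) := by
    refine tendsto_integral_of_dominated_convergence (fun y => C * majorant n y)
      (fun j => (mh'.mul mg).mul (mχ j)) ((integrable_majorant n).const_mul C) (fun j => ?_) ?_
    · filter_upwards [ae_ne_zero n] with y hy
      rw [norm_mul, Real.norm_eq_abs, Real.norm_eq_abs]
      exact (mul_le_of_le_one_right (abs_nonneg _) (hχ j y)).trans (h1 y hy)
    · filter_upwards [ae_ne_zero n] with y hy
      simpa using (tendsto_radialCutoff n hy).const_mul (fderiv ℝ h y v * g y)
  have t2 : Tendsto (fun j => ∫ y, (h y * fderiv ℝ g y v * radialCutoff n j y +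
        h y * g y * fderiv ℝ (radialCutoff n j) y v)) atTop
      (𝓝 (∫ y, h y * fderiv ℝ g y v)) := by
    refine tendsto_integral_of_dominated_convergence
      (fun y => (C + M * ‖v‖ * C) * majorant n y)
      (fun j => ((mh.mul mg').mul (mχ j)).add ((mh.mul mg).mul (mχ' j)))
      ((integrable_majorant n).const_mul _) (fun j => ?_) ?_
    · filter_upwards [ae_ne_zero n] with y hy
      refine (norm_add_le _ _).trans ?_
      rw [norm_mul, norm_mul _ (fderiv ℝ (radialCutoff n j) y v)]
      simp only [Real.norm_eq_abs]
      have e1 := (mul_le_of_le_one_right (abs_nonneg _) (hχ j y)).trans (h2 y hy)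
      have e2 : |h y * g y| * |fderiv ℝ (radialCutoff n j) y v| ≤
          M * ‖v‖ * (|h y * g y| * ‖y‖⁻¹) := by
        calc _ ≤ |h y * g y| * (M * (‖v‖ * ‖y‖⁻¹)) := by gcongr; exact hM j y v
          _ = _ := by ring
      have e3 : M * ‖v‖ * (|h y * g y| * ‖y‖⁻¹) ≤ M * ‖v‖ * (C * majorant n y) := by
        exact mul_le_mul_of_nonneg_left (h3 y hy) (by positivity)
      linarith
    · filter_upwards [ae_ne_zero n] with y hy
      simpa using ((tendsto_radialCutoff n hy).const_mul (h y * fderiv ℝ g y v)).add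
        ((tendsto_fderiv_radialCutoff n hy v).const_mul (h y * g y))
  refine tendsto_nhds_unique t1 ?_
  simp_rw [step]
  exact t2.neg

/-- Interchange of two partial derivatives under the integral sign, under decay conditions. -/
theorem integral_fderiv_mul_fderiv_comm {n : ℕ} {h g : Euc n → ℝ}
    (hh : LocallyLipschitzOn {0}ᶜ h) (hg : ContDiff ℝ 2 g) (v w : Euc n) {C : ℝ}
    (h1 : ∀ y ≠ 0, ∀ a b, (a = v ∨ a = w) → (b = v ∨ b = w) →
      |fderiv ℝ h y a * fderiv ℝ g y b| ≤ C * majorant n y)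
    (h2 : ∀ y ≠ 0, ∀ b, (b = v ∨ b = w) → |h y * fderiv ℝ g y b| * ‖y‖⁻¹ ≤ C * majorant n y) :
    ∫ y, fderiv ℝ h y w * fderiv ℝ g y v = ∫ y, fderiv ℝ h y v * fderiv ℝ g y w := by
  obtain ⟨M, hM0, hM⟩ := exists_bound_fderiv_radialCutoff n
  have mh : AEStronglyMeasurable h volume :=
    aestronglyMeasurable_of_continuousOn_compl hh.continuousOn
  have mh' (v) : AEStronglyMeasurable (fun y => fderiv ℝ h y v) volume :=
    (measurable_fderiv_apply_const ℝ h v).aestronglyMeasurable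
  have mg' (v) : AEStronglyMeasurable (fun y => fderiv ℝ g y v) volume :=
    (measurable_fderiv_apply_const ℝ g v).aestronglyMeasurable
  have mχ (j) : AEStronglyMeasurable (radialCutoff n j) volume :=
    (contDiff_radialCutoff n j).continuous.aestronglyMeasurable
  have mχ' (j) (v) : AEStronglyMeasurable (fun y => fderiv ℝ (radialCutoff n j) y v) volume :=
    (measurable_fderiv_apply_const ℝ _ v).aestronglyMeasurable
  have hχ (j : ℕ) (y : Euc n) : |radialCutoff n j y| ≤ 1 := by
    unfold radialCutoff
    rw [abs_of_nonneg (cutoffProfile_nonneg _ _)]; exact cutoffProfile_le_one _ _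
  have hgv (v : Euc n) : ContDiff ℝ 1 (fun y => fderiv ℝ g y v) :=
    (hg.fderiv_right (m := 1) (by norm_num)).clm_apply contDiff_const
  have hsymm (y : Euc n) : fderiv ℝ (fun y => fderiv ℝ g y v) y w =
      fderiv ℝ (fun y => fderiv ℝ g y w) y v := by
    have hd : DifferentiableAt ℝ (fderiv ℝ g) y :=
      (hg.fderiv_right (m := 1) (by norm_num)).differentiable (by simp) y
    have hs := (hg.contDiffAt (x := y)).isSymmSndFDerivAt (by simp)
    rw [fderiv_clm_apply hd (differentiableAt_const v),
      fderiv_clm_apply hd (differentiableAt_const w)]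
    simpa using hs w v
  have step (j : ℕ) : ∫ y, fderiv ℝ h y w * (fderiv ℝ g y v * radialCutoff n j y) =
      (∫ y, fderiv ℝ h y v * (fderiv ℝ g y w * radialCutoff n j y)) -
      ∫ y, (h y * fderiv ℝ g y v * fderiv ℝ (radialCutoff n j) y w -
        h y * fderiv ℝ g y w * fderiv ℝ (radialCutoff n j) y v) := by
    have hd := contDiff_radialCutoff n j
    have h0 (v) : (0 : Euc n) ∉ tsupport (fun y => fderiv ℝ g y v * radialCutoff n j y) :=
      fun h0 => zero_notMem_tsupport_radialCutoff n j (tsupport_mul_subset_right h0)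
    have hcs (v) : HasCompactSupport (fun y => fderiv ℝ g y v * radialCutoff n j y) :=
      (hasCompactSupport_radialCutoff n j).mul_left
    rw [integral_fderiv_mul_eq_neg hh ((hgv v).mul hd) (hcs v) (h0 v) w,
      integral_fderiv_mul_eq_neg hh ((hgv w).mul hd) (hcs w) (h0 w) v]
    have i1 := integrable_mul_fderiv_of_compact hh.continuousOn ((hgv v).mul hd) (hcs v) (h0 v) w
    have i2 := integrable_mul_fderiv_of_compact hh.continuousOn ((hgv w).mul hd) (hcs w) (h0 w) v
    have : ∫ y, (h y * fderiv ℝ g y v * fderiv ℝ (radialCutoff n j) y w -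
        h y * fderiv ℝ g y w * fderiv ℝ (radialCutoff n j) y v) =
        ∫ y, (h y * fderiv ℝ (fun y => fderiv ℝ g y v * radialCutoff n j y) y w -
          h y * fderiv ℝ (fun y => fderiv ℝ g y w * radialCutoff n j y) y v) := by
      congr 1
      ext y
      rw [fderiv_fun_mul ((hgv v).differentiable (by simp) y) (hd.differentiable (by simp) y),
        fderiv_fun_mul ((hgv w).differentiable (by simp) y) (hd.differentiable (by simp) y)]
      simp only [add_apply, smul_apply, smul_eq_mul]
      rw [hsymm y]
      ring
    rw [this, integral_sub i1 i2]
    ring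
  have t1 (a b : Euc n) (ha : a = v ∨ a = w) (hb : b = v ∨ b = w) :
      Tendsto (fun j => ∫ y, fderiv ℝ h y a * (fderiv ℝ g y b * radialCutoff n j y)) atTop
      (𝓝 (∫ y, fderiv ℝ h y a * fderiv ℝ g y b)) := by
    refine tendsto_integral_of_dominated_convergence (fun y => C * majorant n y)
      (fun j => (mh' a).mul ((mg' b).mul (mχ j)))
      ((integrable_majorant n).const_mul C) (fun j => ?_) ?_
    · filter_upwards [ae_ne_zero n] with y hy
      rw [← mul_assoc, norm_mul, Real.norm_eq_abs, Real.norm_eq_abs]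
      exact (mul_le_of_le_one_right (abs_nonneg _) (hχ j y)).trans (h1 y hy a b ha hb)
    · filter_upwards [ae_ne_zero n] with y hy
      simpa [mul_assoc] using
        (tendsto_radialCutoff n hy).const_mul (fderiv ℝ h y a * fderiv ℝ g y b)
  have t2 : Tendsto (fun j => ∫ y, (h y * fderiv ℝ g y v * fderiv ℝ (radialCutoff n j) y w -
        h y * fderiv ℝ g y w * fderiv ℝ (radialCutoff n j) y v)) atTop (𝓝 0) := by
    have : (0 : ℝ) = ∫ y : Euc n, (0 : ℝ) := by simp
    rw [this]
    refine tendsto_integral_of_dominated_convergence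
      (fun y => (M * ‖w‖ * C + M * ‖v‖ * C) * majorant n y)
      (fun j => ((mh.mul (mg' v)).mul (mχ' j w)).sub ((mh.mul (mg' w)).mul (mχ' j v)))
      ((integrable_majorant n).const_mul _) (fun j => ?_) ?_
    · filter_upwards [ae_ne_zero n] with y hy
      refine (norm_sub_le _ _).trans ?_
      have e2 (a b) (ha : a = v ∨ a = w) : ‖h y * fderiv ℝ g y a * fderiv ℝ (radialCutoff n j) y b‖
          ≤ M * ‖b‖ * (C * majorant n y) := by
        rw [norm_mul, Real.norm_eq_abs, Real.norm_eq_abs]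
        calc _ ≤ |h y * fderiv ℝ g y a| * (M * (‖b‖ * ‖y‖⁻¹)) := by gcongr; exact hM j y b
          _ = M * ‖b‖ * (|h y * fderiv ℝ g y a| * ‖y‖⁻¹) := by ring
          _ ≤ _ := mul_le_mul_of_nonneg_left (h2 y hy a ha) (by positivity)
      linarith [e2 v w (Or.inl rfl), e2 w v (Or.inr rfl)]
    · filter_upwards [ae_ne_zero n] with y hy
      simpa using ((tendsto_fderiv_radialCutoff n hy w).const_mul (h y * fderiv ℝ g y v)).sub
        ((tendsto_fderiv_radialCutoff n hy v).const_mul (h y * fderiv ℝ g y w))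
  refine tendsto_nhds_unique (t1 w v (Or.inr rfl) (Or.inl rfl)) ?_
  simp_rw [step]
  simpa using (t1 v w (Or.inl rfl) (Or.inr rfl)).sub t2

/-- The regularised length `√(|z|² + ε²)`. -/
noncomputable def regLength {n : ℕ} (ε : ℝ) (z : Euc n) : ℝ := √(‖z‖ ^ 2 + ε ^ 2)

/-- The regularised kernel `z / √(|z|² + ε²) ^ (n+1)`. -/
noncomputable def kernel (n : ℕ) (ε : ℝ) (z : Euc n) : Euc n := ((regLength ε z) ^ (n + 1))⁻¹ • z

/-- The derivative of the regularised kernel. -/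
noncomputable def kernelDeriv (n : ℕ) (ε : ℝ) (z : Euc n) : Euc n →L[ℝ] Euc n :=
  ((regLength ε z) ^ (n + 1))⁻¹ • ContinuousLinearMap.id ℝ (Euc n) -
    ((n + 1) * ((regLength ε z) ^ (n + 3))⁻¹) • (innerSL ℝ z).smulRight z

/-- The divergence of the regularised kernel, a multiple of an approximate identity. -/
noncomputable def kernelTrace (n : ℕ) (ε : ℝ) (z : Euc n) : ℝ :=
  (n + 1) * ε ^ 2 * ((regLength ε z) ^ (n + 3))⁻¹

section
variable {n : ℕ}

theorem regLength_nonneg (ε : ℝ) (z : Euc n) : 0 ≤ regLength ε z := Real.sqrt_nonneg _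

theorem regLength_sq (ε : ℝ) (z : Euc n) : regLength ε z ^ 2 = ‖z‖ ^ 2 + ε ^ 2 :=
  Real.sq_sqrt (by positivity)

theorem norm_le_regLength (ε : ℝ) (z : Euc n) : ‖z‖ ≤ regLength ε z :=
  Real.le_sqrt_of_sq_le (by nlinarith [sq_nonneg ε])

theorem le_regLength (ε : ℝ) (z : Euc n) : ε ≤ regLength ε z :=
  Real.le_sqrt_of_sq_le (by nlinarith [sq_nonneg ‖z‖])

theorem regLength_pos {ε : ℝ} (hε : 0 < ε) (z : Euc n) : 0 < regLength ε z :=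
  hε.trans_le (le_regLength ε z)

theorem regLength_zero (z : Euc n) : regLength 0 z = ‖z‖ := by
  simp [regLength, Real.sqrt_sq (norm_nonneg z)]

theorem regLength_le {ε : ℝ} (hε : 0 ≤ ε) (z : Euc n) : regLength ε z ≤ ‖z‖ + ε := by
  refine Real.sqrt_le_iff.2 ⟨by positivity, ?_⟩
  nlinarith [mul_nonneg hε (norm_nonneg z)]

theorem regLength_mono {ε δ : ℝ} (hε : 0 ≤ ε) (h : ε ≤ δ) (z : Euc n) :
    regLength ε z ≤ regLength δ z := by
  unfold regLength; gcongr

theorem one_add_norm_le_regLength {ε : ℝ} (hε : 0 < ε) (z : Euc n) :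
    1 + ‖z‖ ≤ (1 + ε⁻¹) * regLength ε z := by
  have h1 := norm_le_regLength ε z
  have h2 : 1 ≤ ε⁻¹ * regLength ε z := by
    rw [← inv_mul_cancel₀ hε.ne']; gcongr; exact le_regLength ε z
  linarith

theorem regLength_neg (ε : ℝ) (z : Euc n) : regLength ε (-z) = regLength ε z := by
  simp [regLength]

theorem regLength_smul {t : ℝ} (ht : 0 < t) (ε : ℝ) (z : Euc n) :
    regLength (t * ε) (t • z) = t * regLength ε z := by
  unfold regLength
  rw [norm_smul, Real.norm_eq_abs, abs_of_pos ht, ← Real.sqrt_sq ht.le,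
    ← Real.sqrt_mul (by positivity),
    Real.sqrt_sq ht.le]
  congr 1; ring

theorem contDiff_regLength {ε : ℝ} (hε : 0 < ε) : ContDiff ℝ 2 (regLength ε : Euc n → ℝ) := by
  unfold regLength
  exact ((contDiff_norm_sq ℝ).add contDiff_const).sqrt fun z => by positivity

theorem continuous_regLength (ε : ℝ) : Continuous (regLength ε : Euc n → ℝ) := by
  unfold regLength; fun_prop

theorem contDiff_kernel {ε : ℝ} (hε : 0 < ε) : ContDiff ℝ 2 (kernel n ε) := by
  unfold kernel
  exact (((contDiff_regLength hε).pow _).inv fun z => by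
    have := regLength_pos hε z; positivity).smul contDiff_id

theorem hasFDerivAt_regLength {ε : ℝ} (hε : 0 < ε) (z : Euc n) :
    HasFDerivAt (regLength ε : Euc n → ℝ) ((regLength ε z)⁻¹ • innerSL ℝ z) z := by
  have h := ((hasStrictFDerivAt_norm_sq z).hasFDerivAt.add_const (ε ^ 2)).sqrt
    (by positivity : ‖z‖ ^ 2 + ε ^ 2 ≠ 0)
  refine h.congr_fderiv ?_
  have := regLength_pos hε z
  ext v
  simp only [smul_apply, smul_eq_mul, nsmul_eq_mul]
  change 1 / (2 * regLength ε z) * _ = _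
  field_simp
  simp

theorem hasFDerivAt_kernel {ε : ℝ} (hε : 0 < ε) (z : Euc n) :
    HasFDerivAt (kernel n ε) (kernelDeriv n ε z) z := by
  have hs := regLength_pos hε z
  have h1 := ((hasDerivAt_pow (n + 1) (regLength ε z)).inv (by positivity)).comp_hasFDerivAt z
    (hasFDerivAt_regLength hε z)
  have h2 := h1.smul (hasFDerivAt_id z)
  refine h2.congr_fderiv ?_
  ext1 v
  simp only [kernelDeriv, Function.comp_def]
  simp only [add_apply, sub_apply, smul_apply, ContinuousLinearMap.smulRight_apply,
    ContinuousLinearMap.id_apply, Pi.inv_apply, smul_eq_mul, id]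
  rw [sub_eq_add_neg, smul_smul, ← neg_smul]
  congr 2
  push_cast
  rw [innerSL_apply_apply]
  field_simp
  ring_nf

theorem kernelDeriv_symm (ε : ℝ) (z a b : Euc n) :
    ⟪kernelDeriv n ε z a, b⟫ = ⟪kernelDeriv n ε z b, a⟫ := by
  simp only [kernelDeriv, sub_apply, smul_apply, ContinuousLinearMap.smulRight_apply,
    ContinuousLinearMap.id_apply, inner_sub_left, inner_smul_left, innerSL_apply_apply]
  rw [real_inner_comm a b]
  simp only [RCLike.conj_to_real]
  ring

theorem sum_kernelDeriv {ε : ℝ} (hε : 0 < ε) (z : Euc n) :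
    ∑ k, ⟪kernelDeriv n ε z (EuclideanSpace.single k 1), EuclideanSpace.single k 1⟫ =
      kernelTrace n ε z := by
  have hs := regLength_pos hε z
  have hsq := regLength_sq ε z
  have hz : ‖z‖ ^ 2 = ∑ k, z k * z k := by
    rw [EuclideanSpace.real_norm_sq_eq]; simp [sq]
  simp only [kernelDeriv, sub_apply, smul_apply, ContinuousLinearMap.smulRight_apply,
    ContinuousLinearMap.id_apply, inner_sub_left, inner_smul_left, innerSL_apply_apply,
    EuclideanSpace.inner_single_right]
  simp [Finset.sum_sub_distrib, ← Finset.mul_sum]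
  rw [← hz, kernelTrace]
  have : ‖z‖ ^ 2 = regLength ε z ^ 2 - ε ^ 2 := by linarith
  rw [this]
  field_simp
  ring

theorem norm_kernelDeriv_le {ε : ℝ} (hε : 0 < ε) (z : Euc n) :
    ‖kernelDeriv n ε z‖ ≤ (n + 2) * ((regLength ε z) ^ (n + 1))⁻¹ := by
  have hs := regLength_pos hε z
  have hz := norm_le_regLength ε z
  refine (norm_sub_le _ _).trans ?_
  rw [norm_smul, norm_smul, ContinuousLinearMap.norm_smulRight_apply, innerSL_apply_norm]
  have h1 : ‖ContinuousLinearMap.id ℝ (Euc n)‖ ≤ 1 := ContinuousLinearMap.norm_id_le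
  rw [Real.norm_of_nonneg (by positivity), Real.norm_of_nonneg (by positivity)]
  have h2 : ‖z‖ * ‖z‖ ≤ regLength ε z ^ 2 := by rw [sq]; gcongr
  calc _ ≤ (regLength ε z ^ (n + 1))⁻¹ * 1 +
        (n + 1) * (regLength ε z ^ (n + 3))⁻¹ * regLength ε z ^ 2 := by gcongr
    _ = _ := by field_simp; ring

theorem norm_kernel (ε : ℝ) (z : Euc n) :
    ‖kernel n ε z‖ = ((regLength ε z) ^ (n + 1))⁻¹ * ‖z‖ := by
  have := regLength_nonneg ε z
  rw [kernel, norm_smul, Real.norm_of_nonneg (by positivity)]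

theorem norm_kernel_le {ε : ℝ} (z : Euc n) : ‖kernel n ε z‖ ≤ ((regLength ε z) ^ n)⁻¹ := by
  rw [norm_kernel]
  have hz := norm_le_regLength ε z
  rcases (regLength_nonneg ε z).eq_or_lt with h | h
  · have : ‖z‖ = 0 := le_antisymm (by linarith) (norm_nonneg z)
    rw [this]; simp [← h]
  · calc _ ≤ (regLength ε z ^ (n + 1))⁻¹ * regLength ε z := by gcongr
      _ = _ := by rw [pow_succ]; field_simp

theorem norm_kernel_le_norm {ε : ℝ} {z : Euc n} (hz : z ≠ 0) :
    ‖kernel n ε z‖ ≤ (‖z‖ ^ n)⁻¹ := by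
  refine (norm_kernel_le z).trans ?_
  have := norm_le_regLength ε z
  gcongr

theorem inv_one_add_norm_sub_le (x y : Euc n) :
    (1 + ‖x - y‖)⁻¹ ≤ (1 + ‖x‖) * (1 + ‖y‖)⁻¹ := by
  have : ‖y‖ ≤ ‖x‖ + ‖x - y‖ := by
    have := norm_sub_le x (x - y); simpa using this
  rw [← div_eq_mul_inv, inv_eq_one_div, div_le_div_iff₀ (by positivity) (by positivity)]
  nlinarith [mul_nonneg (norm_nonneg x) (norm_nonneg (x - y))]

theorem inv_regLength_sub_le {ε : ℝ} (hε : 0 < ε) (x y : Euc n) :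
    (regLength ε (x - y))⁻¹ ≤ (1 + ε⁻¹) * (1 + ‖x‖) * (1 + ‖y‖)⁻¹ := by
  have hs := regLength_pos hε (x - y)
  have h1 := one_add_norm_le_regLength hε (x - y)
  calc (regLength ε (x - y))⁻¹ ≤ (1 + ε⁻¹) * (1 + ‖x - y‖)⁻¹ := by
        rw [← div_eq_mul_inv, inv_eq_one_div, div_le_div_iff₀ (by positivity) (by positivity)]
        linarith
    _ ≤ (1 + ε⁻¹) * ((1 + ‖x‖) * (1 + ‖y‖)⁻¹) := by gcongr; exact inv_one_add_norm_sub_le x y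
    _ = _ := by ring

theorem norm_kernel_sub_le {ε : ℝ} (hε : 0 < ε) (x y : Euc n) :
    ‖kernel n ε (x - y)‖ ≤ ((1 + ε⁻¹) * (1 + ‖x‖)) ^ n * ((1 + ‖y‖) ^ n)⁻¹ := by
  refine (norm_kernel_le _).trans ?_
  rw [← inv_pow, ← inv_pow, ← mul_pow]
  have := regLength_pos hε (x - y)
  gcongr
  exact inv_regLength_sub_le hε x y

theorem norm_kernelDeriv_sub_le {ε : ℝ} (hε : 0 < ε) (x y : Euc n) :
    ‖kernelDeriv n ε (x - y)‖ ≤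
      (n + 2) * ((1 + ε⁻¹) * (1 + ‖x‖)) ^ (n + 1) * ((1 + ‖y‖) ^ (n + 1))⁻¹ := by
  refine (norm_kernelDeriv_le hε _).trans ?_
  rw [mul_assoc, ← inv_pow, ← inv_pow, ← mul_pow]
  have := regLength_pos hε (x - y)
  gcongr
  exact inv_regLength_sub_le hε x y

theorem inv_mul_inv_le_majorant {a b : ℕ} (ha : a ≤ n) (hab : a + b = n + 2) {y : Euc n}
    (hy : y ≠ 0) : (‖y‖ ^ a)⁻¹ * ((1 + ‖y‖) ^ b)⁻¹ ≤ majorant n y := by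
  have h0 : 0 < ‖y‖ := norm_pos_iff.2 hy
  rw [majorant, ← mul_inv]
  refine inv_anti₀ (by positivity) ?_
  obtain ⟨d, rfl⟩ := Nat.exists_eq_add_of_le ha
  obtain rfl : b = d + 2 := by omega
  have : ‖y‖ ^ d ≤ (1 + ‖y‖) ^ d := by gcongr; linarith
  calc _ = ‖y‖ ^ a * ‖y‖ ^ d * (1 + ‖y‖) ^ 2 := by ring
    _ ≤ ‖y‖ ^ a * (1 + ‖y‖) ^ d * (1 + ‖y‖) ^ 2 := by gcongr
    _ = _ := by ring

theorem continuous_kernelDeriv {ε : ℝ} (hε : 0 < ε) : Continuous (kernelDeriv n ε) := by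
  have h : kernelDeriv n ε = fderiv ℝ (kernel n ε) := by
    ext1 z; exact (hasFDerivAt_kernel hε z).fderiv.symm
  rw [h]
  exact (contDiff_kernel hε).continuous_fderiv (by simp)

theorem kernel_neg (ε : ℝ) (z : Euc n) : kernel n ε (-z) = -kernel n ε z := by
  simp [kernel, regLength_neg]

theorem norm_kernel_zero_sub_le {ε : ℝ} (hε : 0 ≤ ε) {z : Euc n} (hz : z ≠ 0) :
    ‖kernel n 0 z - kernel n ε z‖ ≤ (n + 1) * ε * (‖z‖ ^ (n + 1))⁻¹ := by
  have h0 : 0 < ‖z‖ := norm_pos_iff.2 hz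
  have hs : 0 < regLength ε z := h0.trans_le (norm_le_regLength ε z)
  rw [kernel, kernel, ← sub_smul, norm_smul, regLength_zero]
  have hb := one_add_mul_le_pow (a := ‖z‖ / regLength ε z - 1)
    (by have : 0 ≤ ‖z‖ / regLength ε z := by positivity
        linarith) (n + 1)
  have h1 : 1 - ‖z‖ / regLength ε z ≤ ε / ‖z‖ := by
    have : ‖z‖ * regLength ε z ≤ ‖z‖ * (‖z‖ + ε) := by gcongr; exact regLength_le hε z
    rw [one_sub_div hs.ne', div_le_div_iff₀ hs h0]
    have := mul_le_mul_of_nonneg_left (norm_le_regLength ε z) hε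
    nlinarith
  have h2 : 1 - (‖z‖ / regLength ε z) ^ (n + 1) ≤ (n + 1) * (ε / ‖z‖) := by
    have : ((n : ℝ) + 1) * (1 - ‖z‖ / regLength ε z) ≤ (n + 1) * (ε / ‖z‖) := by gcongr
    push_cast at hb
    rw [add_sub_cancel] at hb
    linarith
  have h3 : (regLength ε z ^ (n + 1))⁻¹ ≤ (‖z‖ ^ (n + 1))⁻¹ := by
    gcongr; exact norm_le_regLength ε z
  rw [Real.norm_of_nonneg (by linarith)]
  calc ((‖z‖ ^ (n + 1))⁻¹ - (regLength ε z ^ (n + 1))⁻¹) * ‖z‖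
      = (‖z‖ ^ n)⁻¹ * (1 - (‖z‖ / regLength ε z) ^ (n + 1)) := by
        rw [div_pow]; field_simp; ring
    _ ≤ (‖z‖ ^ n)⁻¹ * ((n + 1) * (ε / ‖z‖)) := by gcongr
    _ = _ := by rw [pow_succ]; field_simp

theorem norm_kernel_sub_kernel_le {ε : ℝ} (hε : 0 ≤ ε) {δ : ℝ} (hδ : ε ≤ δ) {z : Euc n}
    (hz : z ≠ 0) : ‖kernel n ε z - kernel n δ z‖ ≤ ‖kernel n 0 z - kernel n δ z‖ := by
  have h0 : 0 < ‖z‖ := norm_pos_iff.2 hz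
  simp only [kernel, ← sub_smul, norm_smul]
  have h1 : (regLength ε z ^ (n + 1))⁻¹ ≤ (regLength 0 z ^ (n + 1))⁻¹ := by
    have : 0 < regLength 0 z := by rwa [regLength_zero]
    gcongr; exact regLength_mono le_rfl hε z
  have h2 : (regLength δ z ^ (n + 1))⁻¹ ≤ (regLength ε z ^ (n + 1))⁻¹ := by
    have : 0 < regLength ε z := h0.trans_le (norm_le_regLength ε z)
    gcongr; exact regLength_mono hε hδ z
  gcongr
  rw [Real.norm_of_nonneg (by linarith), Real.norm_of_nonneg (by linarith)]
  linarith

theorem norm_kernel_zero_sub_le' {ε : ℝ} {z : Euc n} (hz : z ≠ 0) :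
    ‖kernel n 0 z - kernel n ε z‖ ≤ (‖z‖ ^ n)⁻¹ := by
  have h0 : 0 < ‖z‖ := norm_pos_iff.2 hz
  simp only [kernel, ← sub_smul, norm_smul]
  have h1 : (regLength ε z ^ (n + 1))⁻¹ ≤ (‖z‖ ^ (n + 1))⁻¹ := by
    gcongr; exact norm_le_regLength ε z
  have h2 : 0 ≤ (regLength ε z ^ (n + 1))⁻¹ := by have := regLength_nonneg ε z; positivity
  rw [regLength_zero, Real.norm_of_nonneg (by linarith)]
  calc _ ≤ (‖z‖ ^ (n + 1))⁻¹ * ‖z‖ := by gcongr; linarith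
    _ = _ := by rw [pow_succ]; field_simp

/-- A two-centre bound: singularities at `0` and `x` of total order `n + 2` at infinity. -/
theorem exists_two_center_bound {a b : ℕ} (ha : a ≤ n) (hab : a + b = 2) {x : Euc n} (hx : x ≠ 0) :
    ∃ C : ℝ, ∀ y ≠ 0, (‖y‖ ^ a)⁻¹ * ((‖x - y‖ ^ n)⁻¹ * ((1 + ‖x - y‖) ^ b)⁻¹) ≤
      C * (majorant n y + majorant n (x - y)) := by
  have hx0 : 0 < ‖x‖ := norm_pos_iff.2 hx
  set A := 2 * (1 + ‖x‖) / ‖x‖ + 1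
  set B := ((‖x‖ / 2) ^ n)⁻¹ * (1 + ‖x‖) ^ (n - a + 2)
  have hA : 0 ≤ A := by positivity
  have hB : 0 ≤ B := by positivity
  refine ⟨A ^ a + B, fun y hy => ?_⟩
  have hy0 : 0 < ‖y‖ := norm_pos_iff.2 hy
  have m1 := majorant_nonneg n y
  have m2 := majorant_nonneg n (x - y)
  by_cases h : ‖x‖ / 2 ≤ ‖y‖
  · have h1 : 1 + ‖x - y‖ ≤ A * ‖y‖ := by
      have := norm_sub_le x y
      have h3 : 1 + ‖x‖ ≤ 2 * (1 + ‖x‖) / ‖x‖ * ‖y‖ := by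
        calc 1 + ‖x‖ = 2 * (1 + ‖x‖) / ‖x‖ * (‖x‖ / 2) := by field_simp
          _ ≤ _ := by gcongr
      simp only [A]; linarith
    have h2 : (‖y‖ ^ a)⁻¹ ≤ A ^ a * ((1 + ‖x - y‖) ^ a)⁻¹ := by
      rw [← div_eq_mul_inv, inv_eq_one_div, div_le_div_iff₀ (by positivity) (by positivity),
        one_mul, ← mul_pow]
      gcongr
    calc _ ≤ A ^ a * ((1 + ‖x - y‖) ^ a)⁻¹ * ((‖x - y‖ ^ n)⁻¹ * ((1 + ‖x - y‖) ^ b)⁻¹) := by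
          gcongr
      _ = A ^ a * majorant n (x - y) := by
          rw [majorant, ← hab, pow_add, mul_inv, mul_inv]; ring
      _ ≤ _ := by nlinarith [pow_nonneg hA a, mul_nonneg (pow_nonneg hA a) m1, mul_nonneg hB m1,
                    mul_nonneg hB m2]
  · push Not at h
    have hz : ‖x‖ / 2 ≤ ‖x - y‖ := by
      have := norm_sub_norm_le x y; linarith
    have h1 : ((‖x - y‖ ^ n)⁻¹ * ((1 + ‖x - y‖) ^ b)⁻¹) ≤ ((‖x‖ / 2) ^ n)⁻¹ * 1 := by
      gcongr
      exact inv_le_one_of_one_le₀ (one_le_pow₀ (by linarith [norm_nonneg (x - y)]))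
    have h2 : (‖y‖ ^ a)⁻¹ ≤ (1 + ‖x‖) ^ (n - a + 2) * majorant n y := by
      have := inv_mul_inv_le_majorant (b := n - a + 2) ha (by omega) hy
      calc (‖y‖ ^ a)⁻¹ = (1 + ‖y‖) ^ (n - a + 2) * ((‖y‖ ^ a)⁻¹ * ((1 + ‖y‖) ^ (n - a + 2))⁻¹) := by
            field_simp
        _ ≤ _ := by gcongr; linarith
    calc _ ≤ (1 + ‖x‖) ^ (n - a + 2) * majorant n y * (((‖x‖ / 2) ^ n)⁻¹ * 1) := by gcongr
      _ = B * majorant n y := by simp only [B]; ring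
      _ ≤ _ := by nlinarith [pow_nonneg hA a, mul_nonneg (pow_nonneg hA a) m1, mul_nonneg hB m1,
                    mul_nonneg hB m2, mul_nonneg (pow_nonneg hA a) m2]

end

section
variable {n : ℕ}

theorem normalize_mem_sphere {y : Euc n} (hy : y ≠ 0) : ‖y‖⁻¹ • y ∈ sphere (0 : Euc n) 1 := by
  simp [norm_smul, norm_ne_zero_iff.2 hy]

theorem exists_bound_of_homogeneous {F : Type*} [NormedAddCommGroup F] {g : Euc n → F}
    {a : ℝ → ℝ} (ha : ∀ t, 0 < t → 0 ≤ a t) (hg : ContinuousOn g {0}ᶜ)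
    (hom : ∀ t, 0 < t → ∀ y ≠ 0, ‖g (t • y)‖ = a t * ‖g y‖) :
    ∃ M : ℝ, 0 ≤ M ∧ ∀ y ≠ 0, ‖g y‖ ≤ M * a ‖y‖ := by
  have hc : ContinuousOn g (sphere 0 1) := hg.mono fun y hy => by
    rintro rfl; simp at hy
  obtain ⟨M, hM⟩ := (isCompact_sphere (0 : Euc n) 1).exists_bound_of_continuousOn hc
  refine ⟨max M 0, le_max_right _ _, fun y hy => ?_⟩
  have h0 : 0 < ‖y‖ := norm_pos_iff.2 hy
  have hs := normalize_mem_sphere hy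
  have h1 := hom ‖y‖ h0 _ (ne_of_mem_sphere hs one_ne_zero)
  rw [smul_inv_smul₀ h0.ne'] at h1
  rw [h1, mul_comm]
  exact mul_le_mul_of_nonneg_right ((hM _ hs).trans (le_max_left _ _)) (ha _ h0)

theorem norm_normalize_sub_le {y z : Euc n} (hy : y ≠ 0) (hz : z ≠ 0) :
    ‖‖y‖⁻¹ • y - ‖z‖⁻¹ • z‖ ≤ 2 * ‖y - z‖ * ‖y‖⁻¹ := by
  have hy0 : 0 < ‖y‖ := norm_pos_iff.2 hy
  have hz0 : 0 < ‖z‖ := norm_pos_iff.2 hz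
  have e : ‖y‖⁻¹ • y - ‖z‖⁻¹ • z = ‖y‖⁻¹ • (y - z) + (‖y‖⁻¹ - ‖z‖⁻¹) • z := by
    module
  rw [e]
  refine (norm_add_le _ _).trans ?_
  rw [norm_smul, norm_smul, norm_inv, norm_norm]
  have h1 : ‖‖y‖⁻¹ - ‖z‖⁻¹‖ * ‖z‖ ≤ ‖y‖⁻¹ * ‖y - z‖ := by
    rw [inv_sub_inv hy0.ne' hz0.ne', norm_div, Real.norm_eq_abs,
      Real.norm_of_nonneg (by positivity)]
    have : |‖z‖ - ‖y‖| ≤ ‖y - z‖ := by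
      rw [abs_sub_comm]; exact abs_norm_sub_norm_le y z
    calc _ = ‖y‖⁻¹ * |‖z‖ - ‖y‖| := by field_simp
      _ ≤ _ := by gcongr
  linarith

/-- Quantitative Lipschitz estimate for the degree `-1` extension of a Lipschitz function on the
sphere. -/
theorem exists_lipschitz_of_homogeneous {f : Euc n → ℝ} {K : NNReal}
    (hlip : LipschitzOnWith K f (sphere 0 1))
    (hom : ∀ t : ℝ, 0 < t → ∀ y : Euc n, y ≠ 0 → f (t • y) = t⁻¹ * f y) :
    ∃ A : ℝ, 0 ≤ A ∧ (∀ y ≠ 0, |f y| ≤ A * ‖y‖⁻¹) ∧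
      ∀ a, 0 < a → ∀ y z : Euc n, a ≤ ‖y‖ → a ≤ ‖z‖ → |f y - f z| ≤ A * (a ^ 2)⁻¹ * ‖y - z‖ := by
  obtain ⟨M, hM⟩ := (isCompact_sphere (0 : Euc n) 1).exists_bound_of_continuousOn hlip.continuousOn
  have key (y : Euc n) (hy : y ≠ 0) : f y = ‖y‖⁻¹ * f (‖y‖⁻¹ • y) := by
    have h0 : 0 < ‖y‖ := norm_pos_iff.2 hy
    rw [hom _ (inv_pos.2 h0) y hy]; field_simp
  have hM' (y : Euc n) (hy : y ≠ 0) : |f (‖y‖⁻¹ • y)| ≤ |M| :=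
    (hM _ (normalize_mem_sphere hy)).trans (le_abs_self M)
  refine ⟨|M| + 2 * K, by positivity, fun y hy => ?_, fun a ha y z hy hz => ?_⟩
  · have h0 : 0 < ‖y‖ := norm_pos_iff.2 hy
    rw [key y hy, abs_mul, abs_of_pos (inv_pos.2 h0), mul_comm]
    have := hM' y hy
    have hK : (0 : ℝ) ≤ 2 * K := by positivity
    gcongr
    linarith
  · have hy0 : 0 < ‖y‖ := ha.trans_le hy
    have hz0 : 0 < ‖z‖ := ha.trans_le hz
    have hy' : y ≠ 0 := norm_pos_iff.1 hy0
    have hz' : z ≠ 0 := norm_pos_iff.1 hz0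
    have hl := hlip.dist_le_mul _ (normalize_mem_sphere hy') _ (normalize_mem_sphere hz')
    rw [Real.dist_eq, dist_eq_norm] at hl
    have hn := norm_normalize_sub_le hy' hz'
    rw [key y hy', key z hz']
    set p := f (‖y‖⁻¹ • y)
    set q := f (‖z‖⁻¹ • z)
    have e : ‖y‖⁻¹ * p - ‖z‖⁻¹ * q = ‖y‖⁻¹ * (p - q) + (‖y‖⁻¹ - ‖z‖⁻¹) * q := by ring
    rw [e]
    refine (abs_add_le _ _).trans ?_
    rw [abs_mul, abs_mul, abs_of_pos (inv_pos.2 hy0)]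
    have h1 : ‖y‖⁻¹ ≤ a⁻¹ := by gcongr
    have h2 : |‖y‖⁻¹ - ‖z‖⁻¹| ≤ a⁻¹ * a⁻¹ * ‖y - z‖ := by
      rw [inv_sub_inv hy0.ne' hz0.ne', abs_div, abs_of_pos (by positivity : 0 < ‖y‖ * ‖z‖),
        abs_sub_comm, div_eq_inv_mul, mul_inv]
      gcongr
      exact abs_norm_sub_norm_le y z
    have h3 : |p - q| ≤ K * (2 * ‖y - z‖ * a⁻¹) := by
      refine hl.trans ?_
      gcongr
      exact hn.trans (by gcongr)
    calc _ ≤ a⁻¹ * (K * (2 * ‖y - z‖ * a⁻¹)) + a⁻¹ * a⁻¹ * ‖y - z‖ * |M| := by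
          have := hM' z hz'
          gcongr
      _ = _ := by rw [← inv_pow]; ring

theorem lipschitzOnWith_compl_ball {f : Euc n → ℝ} {A : ℝ} (hA : 0 ≤ A)
    (h : ∀ a, 0 < a → ∀ y z : Euc n, a ≤ ‖y‖ → a ≤ ‖z‖ → |f y - f z| ≤ A * (a ^ 2)⁻¹ * ‖y - z‖)
    {y : Euc n} (hy : y ≠ 0) :
    LipschitzOnWith (A * ((‖y‖ / 2) ^ 2)⁻¹).toNNReal f (ball y (‖y‖ / 2)) := by
  have h0 : 0 < ‖y‖ := norm_pos_iff.2 hy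
  refine LipschitzOnWith.of_dist_le_mul fun z hz w hw => ?_
  rw [Real.dist_eq, dist_eq_norm, Real.coe_toNNReal _ (by positivity)]
  have aux (z : Euc n) (hz : z ∈ ball y (‖y‖ / 2)) : ‖y‖ / 2 ≤ ‖z‖ := by
    rw [mem_ball_iff_norm'] at hz
    have := norm_sub_norm_le y z
    linarith
  exact h _ (by positivity) z w (aux z hz) (aux w hw)

theorem locallyLipschitzOn_of_estimate {f : Euc n → ℝ} {A : ℝ} (hA : 0 ≤ A)
    (h : ∀ a, 0 < a → ∀ y z : Euc n, a ≤ ‖y‖ → a ≤ ‖z‖ → |f y - f z| ≤ A * (a ^ 2)⁻¹ * ‖y - z‖) :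
    LocallyLipschitzOn {0}ᶜ f := fun y hy =>
  ⟨_, _, mem_nhdsWithin_of_mem_nhds (ball_mem_nhds y (by
    have : 0 < ‖y‖ := norm_pos_iff.2 hy
    positivity)), lipschitzOnWith_compl_ball hA h hy⟩

theorem norm_fderiv_le_of_estimate {f : Euc n → ℝ} {A : ℝ} (hA : 0 ≤ A)
    (h : ∀ a, 0 < a → ∀ y z : Euc n, a ≤ ‖y‖ → a ≤ ‖z‖ → |f y - f z| ≤ A * (a ^ 2)⁻¹ * ‖y - z‖)
    {y : Euc n} (hy : y ≠ 0) : ‖fderiv ℝ f y‖ ≤ 4 * A * (‖y‖ ^ 2)⁻¹ := by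
  have h0 : 0 < ‖y‖ := norm_pos_iff.2 hy
  have := norm_fderiv_le_of_lipschitzOn ℝ (ball_mem_nhds y (by positivity : 0 < ‖y‖ / 2))
    (lipschitzOnWith_compl_ball hA h hy)
  rw [Real.coe_toNNReal _ (by positivity)] at this
  refine this.trans (le_of_eq ?_)
  field_simp; norm_num

theorem kernelTrace_nonneg (ε : ℝ) (z : Euc n) : 0 ≤ kernelTrace n ε z := by
  have := regLength_nonneg ε z
  unfold kernelTrace; positivity

theorem continuous_kernelTrace {ε : ℝ} (hε : 0 < ε) : Continuous (kernelTrace n ε) := by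
  unfold kernelTrace
  refine continuous_const.mul (((continuous_regLength ε).pow _).inv₀ fun z => ?_)
  have := regLength_pos hε z
  simp only [Pi.pow_apply]
  positivity

theorem kernelTrace_sub_le {ε : ℝ} (hε : 0 < ε) (x y : Euc n) :
    kernelTrace n ε (x - y) ≤
      (n + 1) * ((1 + ε⁻¹) * (1 + ‖x‖)) ^ (n + 1) * ((1 + ‖y‖) ^ (n + 1))⁻¹ := by
  have hs := regLength_pos hε (x - y)
  have h1 : kernelTrace n ε (x - y) ≤ (n + 1) * ((regLength ε (x - y)) ^ (n + 1))⁻¹ := by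
    unfold kernelTrace
    calc _ ≤ (n + 1) * regLength ε (x - y) ^ 2 * (regLength ε (x - y) ^ (n + 3))⁻¹ := by
          gcongr; exact le_regLength ε _
      _ = _ := by rw [pow_add _ n 3, pow_add _ n 1]; field_simp
  refine h1.trans ?_
  rw [mul_assoc, ← inv_pow, ← inv_pow, ← mul_pow]
  gcongr
  exact inv_regLength_sub_le hε x y

theorem integrable_kernelTrace_mul (hn : 1 ≤ n) {ε : ℝ} (hε : 0 < ε) (x : Euc n) {g : Euc n → ℝ}
    (hg : ContinuousOn g {0}ᶜ) {M : ℝ} (hM : ∀ y ≠ 0, |g y| ≤ M * ‖y‖⁻¹) :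
    Integrable (fun y => kernelTrace n ε (x - y) * g y) := by
  refine ((integrable_majorant n).const_mul
    ((n + 1) * ((1 + ε⁻¹) * (1 + ‖x‖)) ^ (n + 1) * M)).mono'
    (((continuous_kernelTrace hε).comp (by fun_prop)).aestronglyMeasurable.mul
      (aestronglyMeasurable_of_continuousOn_compl hg)) ?_
  filter_upwards [ae_ne_zero n] with y hy
  have hM0 : 0 ≤ M * ‖y‖⁻¹ := (abs_nonneg _).trans (hM y hy)
  have h0 : 0 < ‖y‖ := norm_pos_iff.2 hy
  have hM0 : 0 ≤ M := nonneg_of_mul_nonneg_left hM0 (by positivity)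
  rw [norm_mul, Real.norm_of_nonneg (kernelTrace_nonneg _ _), Real.norm_eq_abs]
  calc _ ≤ ((n + 1) * ((1 + ε⁻¹) * (1 + ‖x‖)) ^ (n + 1) * ((1 + ‖y‖) ^ (n + 1))⁻¹) * (M * ‖y‖⁻¹) :=
        mul_le_mul (kernelTrace_sub_le hε x y) (hM y hy) (abs_nonneg _) (by positivity)
    _ = ((n + 1) * ((1 + ε⁻¹) * (1 + ‖x‖)) ^ (n + 1) * M) *
        ((‖y‖ ^ 1)⁻¹ * ((1 + ‖y‖) ^ (n + 1))⁻¹) := by rw [pow_one]; ring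
    _ ≤ _ := by
        have := inv_mul_inv_le_majorant (b := n + 1) hn (by omega) hy
        gcongr

/-- The mass of the approximate identity `kernelTrace`. -/
noncomputable def kernelMass (n : ℕ) : ℝ := ∫ z, kernelTrace n 1 z

theorem integrable_kernelTrace_one : Integrable (kernelTrace n 1) := by
  refine ((integrable_majorant n).const_mul ((n + 1) * 2 ^ 2)).mono'
    (continuous_kernelTrace one_pos).aestronglyMeasurable ?_
  filter_upwards [ae_ne_zero n] with z hz
  rw [Real.norm_of_nonneg (kernelTrace_nonneg _ _), kernelTrace, majorant,
    one_pow, mul_one, mul_assoc]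
  have h0 : 0 < ‖z‖ := norm_pos_iff.2 hz
  have hs := regLength_pos one_pos z
  have h1 := one_add_norm_le_regLength one_pos z
  have h2 := le_regLength 1 z
  have h3 := norm_le_regLength 1 z
  gcongr
  rw [← div_eq_mul_inv, inv_eq_one_div, div_le_div_iff₀ (by positivity) (by positivity)]
  norm_num at h1
  have : (1 + ‖z‖) ^ 2 ≤ (2 * regLength 1 z) ^ 2 := by gcongr
  calc 1 * (‖z‖ ^ n * (1 + ‖z‖) ^ 2) ≤ 1 * (regLength 1 z ^ n * (2 * regLength 1 z) ^ 2) := by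
        gcongr
    _ ≤ regLength 1 z * (regLength 1 z ^ n * (2 * regLength 1 z) ^ 2) := by gcongr
    _ = _ := by ring

theorem kernelMass_pos (n : ℕ) : 0 < kernelMass n := by
  unfold kernelMass
  have hpos (z : Euc n) : 0 < kernelTrace n 1 z := by
    have := regLength_pos one_pos z
    unfold kernelTrace; positivity
  rw [integral_pos_iff_support_of_nonneg (fun z => (hpos z).le) integrable_kernelTrace_one]
  have : Function.support (kernelTrace n 1) = univ := by
    ext z; simp [(hpos z).ne']
  rw [this]
  simp

theorem kernelTrace_scale {c : ℝ} (hc : 0 < c) (z : Euc n) :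
    c ^ (n + 1) * kernelTrace n 1 (c • z) = kernelTrace n c⁻¹ z := by
  have h := regLength_smul hc c⁻¹ z
  rw [mul_inv_cancel₀ hc.ne'] at h
  have := regLength_pos (inv_pos.2 hc) z
  rw [kernelTrace, kernelTrace, h]
  field_simp
  ring

theorem tendsto_integral_kernelTrace_of_integrable {g : Euc n → ℝ} (hg : Integrable g) {x : Euc n}
    (hx : ContinuousAt g x) :
    Tendsto (fun ε => ∫ y, kernelTrace n ε (x - y) * g y) (𝓝[>] 0) (𝓝 (kernelMass n * g x)) := by
  have hm := kernelMass_pos n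
  have hlim : Tendsto (fun z : Euc n => ‖z‖ ^ Module.finrank ℝ (Euc n) *
      ((kernelMass n)⁻¹ * kernelTrace n 1 z)) (Bornology.cobounded (Euc n)) (𝓝 0) := by
    have h1 : Tendsto (fun z : Euc n => (kernelMass n)⁻¹ * (n + 1) * (‖z‖ ^ 2)⁻¹)
        (Bornology.cobounded (Euc n)) (𝓝 0) := by
      have := ((tendsto_pow_atTop two_ne_zero).comp
        (tendsto_norm_cobounded_atTop (E := Euc n))).inv_tendsto_atTop.const_mul
          ((kernelMass n)⁻¹ * (n + 1))
      simpa using this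
    refine squeeze_zero' (Eventually.of_forall fun z => ?_) ?_ h1
    · have := kernelTrace_nonneg 1 z
      positivity
    · filter_upwards [Bornology.eventually_ne_cobounded (0 : Euc n)] with z hz
      have h0 : 0 < ‖z‖ := norm_pos_iff.2 hz
      have h3 := norm_le_regLength 1 z
      rw [finrank_euclideanSpace, Fintype.card_fin, kernelTrace]
      calc _ ≤ ‖z‖ ^ (n + 1) * ((kernelMass n)⁻¹ * ((n + 1) * 1 ^ 2 * (‖z‖ ^ (n + 3))⁻¹)) := by
            gcongr
        _ = _ := by rw [pow_add _ n 3, pow_add _ n 1]; field_simp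
  have h := tendsto_integral_comp_smul_smul_of_integrable' (μ := (volume : Measure (Euc n)))
    (φ := fun z => (kernelMass n)⁻¹ * kernelTrace n 1 z)
    (fun z => mul_nonneg (inv_nonneg.2 hm.le) (kernelTrace_nonneg 1 z))
    (by rw [integral_const_mul]; exact inv_mul_cancel₀ hm.ne') hlim hg hx
  have h2 := (h.comp tendsto_inv_nhdsGT_zero).const_mul (kernelMass n)
  refine h2.congr' ?_
  filter_upwards [self_mem_nhdsWithin] with ε hε
  have hε : 0 < ε := hε
  simp only [Function.comp, finrank_euclideanSpace, Fintype.card_fin, smul_eq_mul]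
  rw [← integral_const_mul]
  congr 1
  ext y
  have := kernelTrace_scale (inv_pos.2 hε) (x - y)
  rw [inv_inv] at this
  rw [← this]
  field_simp

theorem tendsto_integral_kernelTrace (hn : 1 ≤ n) {g : Euc n → ℝ} (hg : ContinuousOn g {0}ᶜ)
    {M : ℝ} (hM : ∀ y ≠ 0, |g y| ≤ M * ‖y‖⁻¹) {x : Euc n} (hx : x ≠ 0) :
    Tendsto (fun ε => ∫ y, kernelTrace n ε (x - y) * g y) (𝓝[>] 0) (𝓝 (kernelMass n * g x)) := by
  have hx0 : 0 < ‖x‖ := norm_pos_iff.2 hx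
  have hM0 : 0 ≤ M := nonneg_of_mul_nonneg_left ((abs_nonneg _).trans (hM x hx)) (by positivity)
  set R := 2 * ‖x‖ with hR
  have hR0 : 0 < R := by positivity
  set g₁ := (ball (0 : Euc n) R).indicator g with hg₁
  have mg := aestronglyMeasurable_of_continuousOn_compl hg
  have i1 : Integrable g₁ := by
    refine ((integrable_majorant n).const_mul (M * (1 + R) ^ (n + 1))).mono'
      (mg.indicator measurableSet_ball) ?_
    filter_upwards [ae_ne_zero n] with y hy
    have h0 : 0 < ‖y‖ := norm_pos_iff.2 hy
    have hmj := majorant_nonneg n y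
    by_cases hyR : y ∈ ball (0 : Euc n) R
    · rw [hg₁, indicator_of_mem hyR, Real.norm_eq_abs]
      refine (hM y hy).trans ?_
      rw [mul_assoc]
      gcongr
      have hyR : ‖y‖ < R := by simpa using hyR
      have := inv_mul_inv_le_majorant (b := n + 1) hn (by omega) hy
      calc ‖y‖⁻¹ = (1 + ‖y‖) ^ (n + 1) * ((‖y‖ ^ 1)⁻¹ * ((1 + ‖y‖) ^ (n + 1))⁻¹) := by
            rw [pow_one]; field_simp
        _ ≤ _ := by gcongr
    · rw [hg₁, indicator_of_notMem hyR, norm_zero]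
      positivity
  have hc : ContinuousAt g₁ x := by
    have : g₁ =ᶠ[𝓝 x] g := by
      filter_upwards [isOpen_ball.mem_nhds
          (by simp [hR]; linarith : x ∈ ball (0 : Euc n) R)] with y hy
      exact indicator_of_mem hy g
    exact (hg.continuousAt (isOpen_compl_singleton.mem_nhds hx)).congr this.symm
  have hgx : g₁ x = g x := indicator_of_mem (by simp [hR]; linarith) g
  have t1 := tendsto_integral_kernelTrace_of_integrable i1 hc
  rw [hgx] at t1
  set C := (n + 1) * 2 ^ (n + 3) * M * ((R ^ 2)⁻¹ * (1 + R⁻¹) ^ 2) with hC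
  have t2 : Tendsto (fun ε => ∫ y, kernelTrace n ε (x - y) * (g y - g₁ y)) (𝓝[>] 0) (𝓝 0) := by
    have hlim : Tendsto (fun ε : ℝ => ε ^ 2 * ∫ y, C * majorant n y) (𝓝[>] 0) (𝓝 0) := by
      have : Tendsto (fun ε : ℝ => ε ^ 2 * ∫ y, C * majorant n y) (𝓝 0)
          (𝓝 (0 ^ 2 * ∫ y, C * majorant n y)) := by
        apply Continuous.tendsto; fun_prop
      simpa using this.mono_left nhdsWithin_le_nhds
    refine squeeze_zero_norm' ?_ hlim
    filter_upwards [self_mem_nhdsWithin] with ε hε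
    have hε : 0 < ε := hε
    rw [← integral_const_mul]
    refine norm_integral_le_of_norm_le (((integrable_majorant n).const_mul C).const_mul _) ?_
    filter_upwards [ae_ne_zero n] with y hy
    have h0 : 0 < ‖y‖ := norm_pos_iff.2 hy
    have hmj := majorant_nonneg n y
    by_cases hyR : y ∈ ball (0 : Euc n) R
    · rw [hg₁, indicator_of_mem hyR, sub_self, mul_zero, norm_zero]
      positivity
    · rw [hg₁, indicator_of_notMem hyR, sub_zero, norm_mul, Real.norm_eq_abs (g y),
        Real.norm_of_nonneg (kernelTrace_nonneg _ _)]
      have hyR : R ≤ ‖y‖ := by simpa using hyR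
      have h1 : ‖y‖ / 2 ≤ regLength ε (x - y) := by
        have := norm_sub_norm_le y x
        rw [norm_sub_rev] at this
        have := norm_le_regLength ε (x - y)
        linarith
      have h2 : 1 + ‖y‖ ≤ (1 + R⁻¹) * ‖y‖ := by
        have : 1 ≤ R⁻¹ * ‖y‖ := by rw [← inv_mul_cancel₀ hR0.ne']; gcongr
        linarith
      calc kernelTrace n ε (x - y) * |g y|
          ≤ ((n + 1) * ε ^ 2 * ((‖y‖ / 2) ^ (n + 3))⁻¹) * (M * ‖y‖⁻¹) := by
            unfold kernelTrace
            gcongr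
            exact hM y hy
        _ = ε ^ 2 * ((n + 1) * 2 ^ (n + 3) * M * ((‖y‖ ^ 2)⁻¹ * ((‖y‖ ^ 2)⁻¹ * (‖y‖ ^ n)⁻¹))) := by
            rw [div_pow, pow_add ‖y‖ n 3]; field_simp
        _ ≤ ε ^ 2 * ((n + 1) * 2 ^ (n + 3) * M *
              ((R ^ 2)⁻¹ * (((1 + R⁻¹) ^ 2 * ((1 + ‖y‖) ^ 2)⁻¹) * (‖y‖ ^ n)⁻¹))) := by
            gcongr
            rw [← div_eq_mul_inv, inv_eq_one_div, div_le_div_iff₀ (by positivity) (by positivity),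
              one_mul, ← mul_pow]
            gcongr
        _ = ε ^ 2 * (C * majorant n y) := by rw [majorant, hC, mul_inv (‖y‖ ^ n)]; ring
  have t3 := t1.add t2
  rw [add_zero] at t3
  refine t3.congr' ?_
  filter_upwards [self_mem_nhdsWithin] with ε hε
  have ig := integrable_kernelTrace_mul hn hε x hg hM
  have ig1 : Integrable (fun y => kernelTrace n ε (x - y) * g₁ y) := by
    have := ig.indicator (measurableSet_ball (x := (0 : Euc n)) (ε := R))
    refine this.congr (Eventually.of_forall fun y => ?_)
    simp only [hg₁]
    by_cases hy : y ∈ ball (0 : Euc n) R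
    · rw [indicator_of_mem hy, indicator_of_mem hy]
    · rw [indicator_of_notMem hy, indicator_of_notMem hy, mul_zero]
  simp_rw [mul_sub]
  rw [integral_sub ig ig1]
  ring

end

/-- A locally Lipschitz function away from the origin with the size and gradient bounds of a
function homogeneous of degree `-1`. -/
structure HasInvDecay {n : ℕ} (f : Euc n → ℝ) (A : ℝ) : Prop where
  nonneg : 0 ≤ A
  lip : LocallyLipschitzOn {0}ᶜ f
  bound : ∀ y ≠ 0, |f y| ≤ A * ‖y‖⁻¹
  fderiv_bound : ∀ y ≠ 0, ‖fderiv ℝ f y‖ ≤ A * (‖y‖ ^ 2)⁻¹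

/-- The convolution of `f` with the derivative of the regularised kernel. -/
noncomputable def regHessian {n : ℕ} (f : Euc n → ℝ) (ε : ℝ) (x : Euc n) : Euc n →L[ℝ] Euc n :=
  ∫ y, f y • kernelDeriv n ε (x - y)

/-- The convolution of the gradient of `f` with the (regularised) kernel. -/
noncomputable def gradConv {n : ℕ} (f : Euc n → ℝ) (ε : ℝ) (x : Euc n) : Euc n →L[ℝ] Euc n :=
  ∫ y, (fderiv ℝ f y).smulRight (kernel n ε (x - y))

/-- The renormalised convolution of `f` with the (regularised) kernel. -/
noncomputable def potential {n : ℕ} (f : Euc n → ℝ) (ε : ℝ) (x : Euc n) : Euc n :=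
  ∫ y, f y • (kernel n ε (x - y) + kernel n 1 y)

section
variable {n : ℕ}

theorem exists_hasInvDecay {f : Euc n → ℝ} {K : NNReal}
    (hlip : LipschitzOnWith K f (sphere 0 1))
    (hom : ∀ t : ℝ, 0 < t → ∀ y : Euc n, y ≠ 0 → f (t • y) = t⁻¹ * f y) :
    ∃ A, HasInvDecay f A := by
  obtain ⟨A, hA, h1, h2⟩ := exists_lipschitz_of_homogeneous hlip hom
  refine ⟨4 * A, by positivity, locallyLipschitzOn_of_estimate hA h2, fun y hy => ?_,
    fun y hy => norm_fderiv_le_of_estimate hA h2 hy⟩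
  refine (h1 y hy).trans ?_
  gcongr
  linarith

theorem measurable_kernel (ε : ℝ) : Measurable (kernel n ε) :=
  (((continuous_regLength ε).measurable.pow_const _).inv).smul measurable_id

theorem ae_ne_and_ne (x : Euc n) : ∀ᵐ y : Euc n, y ≠ 0 ∧ x - y ≠ 0 := by
  have h : ∀ᵐ y : Euc n, y ≠ x :=
    compl_mem_ae_iff.2 (measure_singleton (μ := (volume : Measure (Euc n))) x)
  filter_upwards [ae_ne_zero n, h] with y h1 h2
  exact ⟨h1, sub_ne_zero.2 h2.symm⟩

theorem norm_smulRight (c : Euc n →L[ℝ] ℝ) (v : Euc n) : ‖c.smulRight v‖ = ‖c‖ * ‖v‖ :=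
  ContinuousLinearMap.norm_smulRight_apply c v

theorem aestronglyMeasurable_gradConv (f : Euc n → ℝ) (ε : ℝ) (x : Euc n) :
    AEStronglyMeasurable (fun y => (fderiv ℝ f y).smulRight (kernel n ε (x - y))) volume := by
  have h1 : StronglyMeasurable (fderiv ℝ f) := (measurable_fderiv ℝ f).stronglyMeasurable
  have h2 : StronglyMeasurable (fun y => kernel n ε (x - y)) :=
    ((measurable_kernel ε).comp (measurable_const.sub measurable_id)).stronglyMeasurable
  have hc : Continuous (fun p : (Euc n →L[ℝ] ℝ) × Euc n => p.1.smulRight p.2) :=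
    (ContinuousLinearMap.smulRightL ℝ (Euc n) (Euc n)).continuous₂
  exact (hc.comp_stronglyMeasurable (h1.prodMk h2)).aestronglyMeasurable

variable {f : Euc n → ℝ} {A : ℝ}

theorem integrable_gradConv (hn : 2 ≤ n) (hf : HasInvDecay f A) (ε : ℝ) {x : Euc n} (hx : x ≠ 0) :
    Integrable (fun y => (fderiv ℝ f y).smulRight (kernel n ε (x - y))) := by
  obtain ⟨C, hC⟩ := exists_two_center_bound (b := 0) hn rfl hx
  refine (((integrable_majorant n).add (integrable_majorant_sub n x)).const_mul (A * C)).mono'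
    (aestronglyMeasurable_gradConv f ε x) ?_
  filter_upwards [ae_ne_and_ne x] with y hy
  rw [norm_smulRight]
  have h1 := hf.fderiv_bound y hy.1
  have h2 := norm_kernel_le_norm (ε := ε) hy.2
  have h3 := hC y hy.1
  have hA := hf.nonneg
  calc _ ≤ A * (‖y‖ ^ 2)⁻¹ * (‖x - y‖ ^ n)⁻¹ := by gcongr
    _ = A * ((‖y‖ ^ 2)⁻¹ * ((‖x - y‖ ^ n)⁻¹ * ((1 + ‖x - y‖) ^ 0)⁻¹)) := by simp; ring
    _ ≤ A * (C * (majorant n y + majorant n (x - y))) := by gcongr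
    _ = _ := by simp only [Pi.add_apply]; ring

/-- The integrable bound for `f • kernelDeriv`, uniform for `x` in a ball. -/
theorem norm_smul_kernelDeriv_le (hn : 1 ≤ n) (hf : HasInvDecay f A) {ε : ℝ} (hε : 0 < ε) {R : ℝ}
    {x : Euc n} (hx : ‖x‖ ≤ R) {y : Euc n} (hy : y ≠ 0) :
    ‖f y • kernelDeriv n ε (x - y)‖ ≤
      A * ((n + 2) * ((1 + ε⁻¹) * (1 + R)) ^ (n + 1)) * majorant n y := by
  have h1 := norm_kernelDeriv_sub_le hε x y
  have h2 := inv_mul_inv_le_majorant (b := n + 1) hn (by omega) hy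
  have hA := hf.nonneg
  have hR : 0 ≤ R := (norm_nonneg x).trans hx
  rw [norm_smul, Real.norm_eq_abs]
  calc _ ≤ (A * ‖y‖⁻¹) *
        ((n + 2) * ((1 + ε⁻¹) * (1 + R)) ^ (n + 1) * ((1 + ‖y‖) ^ (n + 1))⁻¹) := by
        refine mul_le_mul (hf.bound y hy) (h1.trans ?_) (norm_nonneg _) (by positivity)
        gcongr
    _ = A * ((n + 2) * ((1 + ε⁻¹) * (1 + R)) ^ (n + 1)) *
        ((‖y‖ ^ 1)⁻¹ * ((1 + ‖y‖) ^ (n + 1))⁻¹) := by rw [pow_one]; ring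
    _ ≤ _ := by gcongr

theorem aestronglyMeasurable_smul_kernelDeriv (hf : HasInvDecay f A) {ε : ℝ} (hε : 0 < ε)
    (x : Euc n) : AEStronglyMeasurable (fun y => f y • kernelDeriv n ε (x - y)) volume :=
  (aestronglyMeasurable_of_continuousOn_compl hf.lip.continuousOn).smul
    ((continuous_kernelDeriv hε).comp (by fun_prop)).aestronglyMeasurable

theorem integrable_smul_kernelDeriv (hn : 1 ≤ n) (hf : HasInvDecay f A) {ε : ℝ} (hε : 0 < ε)
    (x : Euc n) : Integrable (fun y => f y • kernelDeriv n ε (x - y)) := by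
  refine ((integrable_majorant n).const_mul
    (A * ((n + 2) * ((1 + ε⁻¹) * (1 + ‖x‖)) ^ (n + 1)))).mono'
    (aestronglyMeasurable_smul_kernelDeriv hf hε x) ?_
  filter_upwards [ae_ne_zero n] with y hy
  exact norm_smul_kernelDeriv_le hn hf hε le_rfl hy

theorem continuous_regHessian (hn : 1 ≤ n) (hf : HasInvDecay f A) {ε : ℝ} (hε : 0 < ε) :
    Continuous (regHessian f ε) := by
  rw [continuous_iff_continuousAt]
  intro x
  refine continuousAt_of_dominated (Eventually.of_forall fun x =>
    aestronglyMeasurable_smul_kernelDeriv hf hε x) ?_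
    ((integrable_majorant n).const_mul (A * ((n + 2) * ((1 + ε⁻¹) * (1 + (‖x‖ + 1))) ^ (n + 1)))) ?_
  · filter_upwards [ball_mem_nhds x one_pos] with x' hx'
    filter_upwards [ae_ne_zero n] with y hy
    refine norm_smul_kernelDeriv_le hn hf hε ?_ hy
    rw [mem_ball_iff_norm] at hx'
    have := norm_sub_norm_le x' x
    linarith
  · refine Eventually.of_forall fun y => ?_
    exact (((continuous_kernelDeriv hε).comp
      (continuous_id.sub continuous_const)).const_smul (f y)).continuousAt

theorem fderiv_inner_kernel {ε : ℝ} (hε : 0 < ε) (x b y a : Euc n) :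
    fderiv ℝ (fun y => ⟪kernel n ε (x - y), b⟫) y a = -⟪kernelDeriv n ε (x - y) a, b⟫ := by
  have h := ((hasFDerivAt_kernel hε (x - y)).comp y ((hasFDerivAt_id y).const_sub x)).inner ℝ
    (hasFDerivAt_const b y)
  have := h.fderiv
  simp only [Function.comp_def] at this
  rw [this]
  simp

theorem contDiff_inner_kernel {ε : ℝ} (hε : 0 < ε) (x b : Euc n) :
    ContDiff ℝ 2 (fun y => ⟪kernel n ε (x - y), b⟫) :=
  ((contDiff_kernel hε).comp (contDiff_const.sub contDiff_id)).inner ℝ contDiff_const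

theorem abs_inner_kernel_le {ε : ℝ} (hε : 0 < ε) (x b y : Euc n) :
    |⟪kernel n ε (x - y), b⟫| ≤
      ((1 + ε⁻¹) * (1 + ‖x‖)) ^ n * ‖b‖ * ((1 + ‖y‖) ^ n)⁻¹ := by
  refine (abs_real_inner_le_norm _ _).trans ?_
  have := mul_le_mul_of_nonneg_right (norm_kernel_sub_le hε x y) (norm_nonneg b)
  linarith

theorem abs_inner_kernelDeriv_le {ε : ℝ} (hε : 0 < ε) (x a b y : Euc n) :
    |⟪kernelDeriv n ε (x - y) a, b⟫| ≤
      (n + 2) * ((1 + ε⁻¹) * (1 + ‖x‖)) ^ (n + 1) * (‖a‖ * ‖b‖) * ((1 + ‖y‖) ^ (n + 1))⁻¹ := by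
  refine (abs_real_inner_le_norm _ _).trans ?_
  have h1 := (kernelDeriv n ε (x - y)).le_opNorm a
  have h2 := norm_kernelDeriv_sub_le hε x y
  calc _ ≤ ((n + 2) * ((1 + ε⁻¹) * (1 + ‖x‖)) ^ (n + 1) * ((1 + ‖y‖) ^ (n + 1))⁻¹ * ‖a‖) * ‖b‖ := by
        gcongr; exact h1.trans (by gcongr)
    _ = _ := by ring

/-- Moving the derivative from the kernel to `f`. -/
theorem regHessian_eq_gradConv (hn : 2 ≤ n) (hf : HasInvDecay f A) {ε : ℝ} (hε : 0 < ε) {x : Euc n}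
    (hx : x ≠ 0) : regHessian f ε x = gradConv f ε x := by
  have hA := hf.nonneg
  have i1 := integrable_smul_kernelDeriv (by omega) hf hε x
  have i2 := integrable_gradConv hn hf ε hx
  ext1 a
  refine ext_inner_right ℝ fun b => ?_
  rw [regHessian, gradConv, ContinuousLinearMap.integral_apply i1,
    ContinuousLinearMap.integral_apply i2,
    real_inner_comm, real_inner_comm b, ← integral_inner (i1.apply_continuousLinearMap a),
    ← integral_inner (i2.apply_continuousLinearMap a)]
  have key := integral_fderiv_mul_eq_neg_of_le (g := fun y => ⟪kernel n ε (x - y), b⟫) hf.lip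
    ((contDiff_inner_kernel hε x b).of_le (by norm_num)) a
    (C := A * ‖a‖ * (((1 + ε⁻¹) * (1 + ‖x‖)) ^ n * ‖b‖) +
      A * ((n + 2) * ((1 + ε⁻¹) * (1 + ‖x‖)) ^ (n + 1) * (‖a‖ * ‖b‖)) +
      A * (((1 + ε⁻¹) * (1 + ‖x‖)) ^ n * ‖b‖)) ?_ ?_ ?_
  · simp only [fderiv_inner_kernel hε, mul_neg, integral_neg, neg_neg] at key
    simp only [smul_apply, ContinuousLinearMap.smulRight_apply, real_inner_comm _ b,
      inner_smul_left, RCLike.conj_to_real]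
    exact key.symm
  all_goals
    intro y hy
    have m0 := majorant_nonneg n y
    have h1 := hf.bound y hy
    have h2 := (fderiv ℝ f y).le_opNorm a
    have h3 := hf.fderiv_bound y hy
    have h4 := abs_inner_kernel_le hε x b y
    have h5 := abs_inner_kernelDeriv_le hε x a b y
    have m1 := inv_mul_inv_le_majorant (b := n + 1) (by omega : 1 ≤ n) (by omega) hy
    have m2 := inv_mul_inv_le_majorant (b := n) hn (by omega) hy
    have n1 : 0 ≤ A * ‖a‖ * (((1 + ε⁻¹) * (1 + ‖x‖)) ^ n * ‖b‖) * majorant n y := by positivity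
    have n2 : 0 ≤ A * ((n + 2) * ((1 + ε⁻¹) * (1 + ‖x‖)) ^ (n + 1) * (‖a‖ * ‖b‖)) *
      majorant n y := by positivity
    have n3 : 0 ≤ A * (((1 + ε⁻¹) * (1 + ‖x‖)) ^ n * ‖b‖) * majorant n y := by positivity
  · rw [abs_mul]
    calc _ ≤ (A * (‖y‖ ^ 2)⁻¹ * ‖a‖) *
          (((1 + ε⁻¹) * (1 + ‖x‖)) ^ n * ‖b‖ * ((1 + ‖y‖) ^ n)⁻¹) := by
          refine mul_le_mul (h2.trans ?_) h4 (abs_nonneg _) (by positivity)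
          gcongr
      _ = A * ‖a‖ * (((1 + ε⁻¹) * (1 + ‖x‖)) ^ n * ‖b‖) *
          ((‖y‖ ^ 2)⁻¹ * ((1 + ‖y‖) ^ n)⁻¹) := by ring
      _ ≤ A * ‖a‖ * (((1 + ε⁻¹) * (1 + ‖x‖)) ^ n * ‖b‖) * majorant n y := by gcongr
      _ ≤ _ := by linarith
  · rw [abs_mul, fderiv_inner_kernel hε, abs_neg]
    calc _ ≤ (A * ‖y‖⁻¹) * ((n + 2) * ((1 + ε⁻¹) * (1 + ‖x‖)) ^ (n + 1) * (‖a‖ * ‖b‖) *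
            ((1 + ‖y‖) ^ (n + 1))⁻¹) := by
          exact mul_le_mul h1 h5 (abs_nonneg _) (by positivity)
      _ = A * ((n + 2) * ((1 + ε⁻¹) * (1 + ‖x‖)) ^ (n + 1) * (‖a‖ * ‖b‖)) *
          ((‖y‖ ^ 1)⁻¹ * ((1 + ‖y‖) ^ (n + 1))⁻¹) := by rw [pow_one]; ring
      _ ≤ A * ((n + 2) * ((1 + ε⁻¹) * (1 + ‖x‖)) ^ (n + 1) * (‖a‖ * ‖b‖)) * majorant n y := by
          gcongr
      _ ≤ _ := by linarith
  · rw [abs_mul]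
    calc _ ≤ ((A * ‖y‖⁻¹) *
          (((1 + ε⁻¹) * (1 + ‖x‖)) ^ n * ‖b‖ * ((1 + ‖y‖) ^ n)⁻¹)) * ‖y‖⁻¹ := by
          gcongr
      _ = A * (((1 + ε⁻¹) * (1 + ‖x‖)) ^ n * ‖b‖) *
          ((‖y‖ ^ 2)⁻¹ * ((1 + ‖y‖) ^ n)⁻¹) := by rw [sq, mul_inv]; ring
      _ ≤ A * (((1 + ε⁻¹) * (1 + ‖x‖)) ^ n * ‖b‖) * majorant n y := by gcongr
      _ ≤ _ := by linarith

theorem tendsto_kernel_zero {z : Euc n} (hz : z ≠ 0) :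
    Tendsto (fun ε => kernel n ε z) (𝓝[>] 0) (𝓝 (kernel n 0 z)) := by
  have h1 : Continuous fun ε : ℝ => regLength ε z := by unfold regLength; fun_prop
  have h0 : regLength 0 z ≠ 0 := by rwa [regLength_zero, norm_ne_zero_iff]
  have : ContinuousAt (fun ε => kernel n ε z) 0 := by
    unfold kernel
    exact ((h1.continuousAt.pow _).inv₀ (pow_ne_zero _ h0)).smul continuousAt_const
  exact this.tendsto.mono_left nhdsWithin_le_nhds

/-- The weighted distance between the kernel and its regularisation. -/
noncomputable def kernelGap (n : ℕ) (ε : ℝ) (z : Euc n) : ℝ :=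
  ‖kernel n 0 z - kernel n ε z‖ * ((1 + ‖z‖) ^ 2)⁻¹

theorem measurable_kernelGap (ε : ℝ) : Measurable (kernelGap n ε) := by
  have h1 := measurable_kernel (n := n) 0
  have h2 := measurable_kernel (n := n) ε
  unfold kernelGap
  fun_prop

theorem norm_kernelGap_le {ε : ℝ} {z : Euc n} (hz : z ≠ 0) :
    ‖kernelGap n ε z‖ ≤ majorant n z := by
  rw [kernelGap, Real.norm_of_nonneg (by positivity), majorant, mul_inv]
  gcongr
  exact norm_kernel_zero_sub_le' hz

theorem integrable_kernelGap (ε : ℝ) : Integrable (kernelGap n ε) := by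
  refine (integrable_majorant n).mono' (measurable_kernelGap ε).aestronglyMeasurable ?_
  filter_upwards [ae_ne_zero n] with z hz
  exact norm_kernelGap_le hz

theorem tendsto_integral_kernelGap :
    Tendsto (fun ε => ∫ z, kernelGap n ε z) (𝓝[>] 0) (𝓝 0) := by
  suffices h : Tendsto (fun ε => ∫ z, kernelGap n ε z) (𝓝[>] 0) (𝓝 (∫ _ : Euc n, (0 : ℝ))) by
    simpa using h
  refine tendsto_integral_filter_of_dominated_convergence (majorant n)
    (Eventually.of_forall fun ε => (measurable_kernelGap ε).aestronglyMeasurable) ?_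
    (integrable_majorant n) ?_
  · filter_upwards [self_mem_nhdsWithin] with ε hε
    filter_upwards [ae_ne_zero n] with z hz
    exact norm_kernelGap_le hz
  · filter_upwards [ae_ne_zero n] with z hz
    have := ((tendsto_kernel_zero hz).const_sub (kernel n 0 z)).norm.mul_const ((1 + ‖z‖) ^ 2)⁻¹
    simpa [kernelGap] using this

theorem exists_gradConv_gap (hn : 2 ≤ n) (hf : HasInvDecay f A) {δ R : ℝ} (hδ : 0 < δ)
    (hR : 0 ≤ R) :
    ∃ b : ℝ → ℝ, Tendsto b (𝓝[>] 0) (𝓝 0) ∧ ∀ ε, 0 < ε → ∀ x : Euc n, 2 * δ ≤ ‖x‖ → ‖x‖ ≤ R →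
      ‖gradConv f 0 x - gradConv f ε x‖ ≤ b ε := by
  have hA := hf.nonneg
  set B := (1 + R) / δ + 1 with hB
  set C := A * ((n + 1) * (δ ^ (n + 1))⁻¹ * (1 + δ) ^ n) with hC
  refine ⟨fun ε => ε * (C * ∫ y, majorant n y) + A * B ^ 2 * ∫ z, kernelGap n ε z, ?_, ?_⟩
  · have h1 : Tendsto (fun ε : ℝ => ε * (C * ∫ y, majorant n y)) (𝓝[>] 0) (𝓝 0) := by
      have : Tendsto (fun ε : ℝ => ε * (C * ∫ y, majorant n y)) (𝓝 0)
          (𝓝 (0 * (C * ∫ y, majorant n y))) := by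
        apply Continuous.tendsto; fun_prop
      simpa using this.mono_left nhdsWithin_le_nhds
    simpa using h1.add (tendsto_integral_kernelGap.const_mul (A * B ^ 2))
  · intro ε hε x hx hxR
    have hx0 : x ≠ 0 := norm_pos_iff.1 (by linarith)
    rw [gradConv, gradConv, ← integral_sub (integrable_gradConv hn hf 0 hx0)
      (integrable_gradConv hn hf ε hx0)]
    have ig : Integrable (fun y => kernelGap n ε (x - y)) :=
      (integrable_kernelGap _).comp_sub_left x
    have e : ε * (C * ∫ y, majorant n y) + A * B ^ 2 * ∫ z, kernelGap n ε z =
        ∫ y, (ε * (C * majorant n y) + A * B ^ 2 * kernelGap n ε (x - y)) := by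
      rw [integral_add (((integrable_majorant n).const_mul C).const_mul ε) (ig.const_mul _),
        integral_const_mul, integral_const_mul, integral_const_mul,
        integral_sub_left_eq_self (kernelGap n ε)]
    beta_reduce
    rw [e]
    refine norm_integral_le_of_norm_le
      ((((integrable_majorant n).const_mul C).const_mul ε).add (ig.const_mul _)) ?_
    filter_upwards [ae_ne_and_ne x] with y hy
    have hy0 : 0 < ‖y‖ := norm_pos_iff.2 hy.1
    have m0 := majorant_nonneg n y
    have g0 : 0 ≤ kernelGap n ε (x - y) := by unfold kernelGap; positivity
    have es : (fderiv ℝ f y).smulRight (kernel n 0 (x - y)) -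
        (fderiv ℝ f y).smulRight (kernel n ε (x - y)) =
        (fderiv ℝ f y).smulRight (kernel n 0 (x - y) - kernel n ε (x - y)) := by
      ext1 v; simp [smul_sub]
    rw [es, norm_smulRight]
    have h1 := hf.fderiv_bound y hy.1
    by_cases h : ‖y‖ < δ
    · have hz : δ ≤ ‖x - y‖ := by have := norm_sub_norm_le x y; linarith
      have h2 : ‖kernel n 0 (x - y) - kernel n ε (x - y)‖ ≤ (n + 1) * ε * (δ ^ (n + 1))⁻¹ := by
        refine (norm_kernel_zero_sub_le hε.le hy.2).trans ?_
        gcongr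
      have h3 : (‖y‖ ^ 2)⁻¹ ≤ (1 + δ) ^ n * majorant n y := by
        have := inv_mul_inv_le_majorant (b := n) hn (by omega) hy.1
        calc (‖y‖ ^ 2)⁻¹ = (1 + ‖y‖) ^ n * ((‖y‖ ^ 2)⁻¹ * ((1 + ‖y‖) ^ n)⁻¹) := by field_simp
          _ ≤ _ := by gcongr
      calc _ ≤ (A * ((1 + δ) ^ n * majorant n y)) * ((n + 1) * ε * (δ ^ (n + 1))⁻¹) := by
            gcongr; exact h1.trans (by gcongr)
        _ = ε * (C * majorant n y) := by rw [hC]; ring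
        _ ≤ _ := le_add_of_nonneg_right (by positivity)
    · push Not at h
      have h2 : 1 + ‖x - y‖ ≤ B * ‖y‖ := by
        have := norm_sub_le x y
        have : 1 + R ≤ (1 + R) / δ * ‖y‖ := by
          calc 1 + R = (1 + R) / δ * δ := by field_simp
            _ ≤ _ := by gcongr
        rw [hB]; linarith
      have h3 : (‖y‖ ^ 2)⁻¹ ≤ B ^ 2 * ((1 + ‖x - y‖) ^ 2)⁻¹ := by
        rw [← div_eq_mul_inv, inv_eq_one_div, div_le_div_iff₀ (by positivity) (by positivity),
          one_mul, ← mul_pow]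
        gcongr
      calc _ ≤ (A * (B ^ 2 * ((1 + ‖x - y‖) ^ 2)⁻¹)) *
            ‖kernel n 0 (x - y) - kernel n ε (x - y)‖ := by
            gcongr; exact h1.trans (by gcongr)
        _ = A * B ^ 2 * kernelGap n ε (x - y) := by rw [kernelGap]; ring
        _ ≤ _ := le_add_of_nonneg_left (by positivity)

theorem tendstoLocallyUniformlyOn_gradConv (hn : 2 ≤ n) (hf : HasInvDecay f A) :
    TendstoLocallyUniformlyOn (fun ε => gradConv f ε) (gradConv f 0) (𝓝[>] 0) {0}ᶜ := by
  rw [Metric.tendstoLocallyUniformlyOn_iff]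
  intro η hη x hx
  have hx0 : 0 < ‖x‖ := norm_pos_iff.2 hx
  obtain ⟨b, hb, h⟩ := exists_gradConv_gap hn hf (by positivity : 0 < ‖x‖ / 4)
    (by positivity : 0 ≤ ‖x‖ * 2)
  refine ⟨ball x (‖x‖ / 2), mem_nhdsWithin_of_mem_nhds (ball_mem_nhds x (by positivity)), ?_⟩
  filter_upwards [self_mem_nhdsWithin, hb.eventually_lt_const hη] with ε hε hlt x' hx'
  rw [mem_ball_iff_norm'] at hx'
  rw [dist_eq_norm]
  have h1 := norm_sub_norm_le x x'
  have h2 := norm_sub_norm_le x' x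
  rw [norm_sub_rev] at h2
  exact (h ε hε x' (by linarith) (by linarith)).trans_lt hlt

theorem tendsto_regHessian (hn : 2 ≤ n) (hf : HasInvDecay f A) {x : Euc n} (hx : x ≠ 0) :
    Tendsto (fun ε => regHessian f ε x) (𝓝[>] 0) (𝓝 (gradConv f 0 x)) := by
  refine ((tendstoLocallyUniformlyOn_gradConv hn hf).tendsto_at hx).congr' ?_
  filter_upwards [self_mem_nhdsWithin] with ε hε
  exact (regHessian_eq_gradConv hn hf hε hx).symm

theorem continuousOn_gradConv (hn : 2 ≤ n) (hf : HasInvDecay f A) :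
    ContinuousOn (gradConv f 0) {0}ᶜ := by
  refine (tendstoLocallyUniformlyOn_gradConv hn hf).continuousOn (Eventually.frequently ?_)
  filter_upwards [self_mem_nhdsWithin] with ε hε
  refine (continuous_regHessian (by omega) hf hε).continuousOn.congr fun x hx => ?_
  exact (regHessian_eq_gradConv hn hf hε hx).symm

end

section
variable {n : ℕ}

theorem norm_kernel_one_sub_le {x y : Euc n} :
    ‖kernel n 1 (x - y) + kernel n 1 y‖ ≤
      (n + 2) * (2 * (1 + ‖x‖)) ^ (n + 1) * ‖x‖ * ((1 + ‖y‖) ^ (n + 1))⁻¹ := by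
  have key := (convex_closedBall (0 : Euc n) ‖x‖).norm_image_sub_le_of_norm_hasFDerivWithin_le
    (f := fun w => kernel n 1 (w - y)) (f' := fun w => kernelDeriv n 1 (w - y))
    (C := (n + 2) * (2 * (1 + ‖x‖)) ^ (n + 1) * ((1 + ‖y‖) ^ (n + 1))⁻¹) (x := 0) (y := x)
    (fun w _ => by
      have h := (hasFDerivAt_kernel one_pos (w - y)).comp w ((hasFDerivAt_id w).sub_const y)
      exact h.hasFDerivWithinAt)
    (fun w hw => by
      rw [mem_closedBall_zero_iff] at hw
      refine (norm_kernelDeriv_sub_le one_pos w y).trans ?_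
      rw [inv_one, one_add_one_eq_two]
      gcongr)
    (by simp) (by simp)
  simp only [zero_sub, kernel_neg, sub_neg_eq_add, sub_zero] at key
  linarith

theorem norm_kernel_sub_kernel_one_le {ε : ℝ} (h0 : 0 ≤ ε) (h1 : ε ≤ 1) {z : Euc n} (hz : z ≠ 0) :
    ‖kernel n ε z - kernel n 1 z‖ ≤ (n + 2) * ((‖z‖ ^ n)⁻¹ * ((1 + ‖z‖) ^ 1)⁻¹) := by
  have hz' : 0 < ‖z‖ := norm_pos_iff.2 hz
  have e1 := norm_kernel_sub_kernel_le h0 h1 hz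
  have e2 := norm_kernel_zero_sub_le zero_le_one hz
  have e3 := norm_kernel_zero_sub_le' (ε := 1) hz
  have e4 : ‖kernel n 0 z - kernel n 1 z‖ * (1 + ‖z‖) ≤ (n + 2) * (‖z‖ ^ n)⁻¹ := by
    have : ‖kernel n 0 z - kernel n 1 z‖ * ‖z‖ ≤ (n + 1) * (‖z‖ ^ n)⁻¹ := by
      calc _ ≤ (n + 1) * 1 * (‖z‖ ^ (n + 1))⁻¹ * ‖z‖ := by gcongr
        _ = _ := by rw [pow_succ]; field_simp
    linarith
  refine e1.trans ?_
  rw [pow_one, ← mul_assoc, ← div_eq_mul_inv, le_div_iff₀ (by positivity)]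
  exact e4

variable {f : Euc n → ℝ} {A : ℝ}

theorem exists_potential_bound (hn : 1 ≤ n) (hf : HasInvDecay f A) {x : Euc n} (hx : x ≠ 0) :
    ∃ C, ∀ ε, 0 ≤ ε → ε ≤ 1 → ∀ y, y ≠ 0 → x - y ≠ 0 →
      ‖f y • (kernel n ε (x - y) + kernel n 1 y)‖ ≤ C * (majorant n y + majorant n (x - y)) := by
  obtain ⟨C, hC⟩ := exists_two_center_bound (a := 1) (b := 1) hn rfl hx
  set D := (n + 2) * (2 * (1 + ‖x‖)) ^ (n + 1) * ‖x‖ with hD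
  have hA := hf.nonneg
  have hD0 : 0 ≤ D := by positivity
  refine ⟨A * ((n + 2) * C + D), fun ε h0 h1 y hy hz => ?_⟩
  have e1 := norm_kernel_sub_kernel_one_le h0 h1 hz
  have e2 := norm_kernel_one_sub_le (x := x) (y := y)
  have e3 := inv_mul_inv_le_majorant (a := 1) (b := n + 1) hn (by omega) hy
  have e4 := hC y hy
  have e5 := hf.bound y hy
  have m1 := majorant_nonneg n (x - y)
  have e6 : kernel n ε (x - y) + kernel n 1 y = (kernel n ε (x - y) - kernel n 1 (x - y)) +
    (kernel n 1 (x - y) + kernel n 1 y) := by abel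
  rw [norm_smul, e6]
  calc _ ≤ (A * ‖y‖⁻¹) * ((n + 2) * ((‖x - y‖ ^ n)⁻¹ * ((1 + ‖x - y‖) ^ 1)⁻¹) +
        D * ((1 + ‖y‖) ^ (n + 1))⁻¹) :=
        mul_le_mul e5 ((norm_add_le _ _).trans (add_le_add e1 e2)) (norm_nonneg _) (by positivity)
    _ = A * ((n + 2) * ((‖y‖ ^ 1)⁻¹ * ((‖x - y‖ ^ n)⁻¹ * ((1 + ‖x - y‖) ^ 1)⁻¹)) +
        D * ((‖y‖ ^ 1)⁻¹ * ((1 + ‖y‖) ^ (n + 1))⁻¹)) := by simp only [pow_one]; ring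
    _ ≤ A * ((n + 2) * (C * (majorant n y + majorant n (x - y))) +
        D * (majorant n y + majorant n (x - y))) := by
        gcongr
        linarith
    _ = _ := by ring

theorem aestronglyMeasurable_potential (hf : HasInvDecay f A) (ε : ℝ) (x : Euc n) :
    AEStronglyMeasurable (fun y => f y • (kernel n ε (x - y) + kernel n 1 y)) volume :=
  (aestronglyMeasurable_of_continuousOn_compl hf.lip.continuousOn).smul
    (((measurable_kernel ε).comp (measurable_const.sub measurable_id)).add
      (measurable_kernel 1)).aestronglyMeasurable

theorem integrable_potential (hn : 1 ≤ n) (hf : HasInvDecay f A) {ε : ℝ} (h0 : 0 ≤ ε) (h1 : ε ≤ 1)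
    {x : Euc n} (hx : x ≠ 0) :
    Integrable (fun y => f y • (kernel n ε (x - y) + kernel n 1 y)) := by
  obtain ⟨C, hC⟩ := exists_potential_bound hn hf hx
  refine (((integrable_majorant n).add (integrable_majorant_sub n x)).const_mul C).mono'
    (aestronglyMeasurable_potential hf ε x) ?_
  filter_upwards [ae_ne_and_ne x] with y hy
  exact hC ε h0 h1 y hy.1 hy.2

theorem tendsto_potential (hn : 1 ≤ n) (hf : HasInvDecay f A) {x : Euc n} (hx : x ≠ 0) :
    Tendsto (fun ε => potential f ε x) (𝓝[>] 0) (𝓝 (potential f 0 x)) := by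
  obtain ⟨C, hC⟩ := exists_potential_bound hn hf hx
  refine tendsto_integral_filter_of_dominated_convergence _
    (Eventually.of_forall fun ε => aestronglyMeasurable_potential hf ε x) ?_
    (((integrable_majorant n).add (integrable_majorant_sub n x)).const_mul C) ?_
  · filter_upwards [Ioo_mem_nhdsGT (zero_lt_one' ℝ)] with ε hε
    filter_upwards [ae_ne_and_ne x] with y hy
    exact hC ε hε.1.le hε.2.le y hy.1 hy.2
  · filter_upwards [ae_ne_and_ne x] with y hy
    exact ((tendsto_kernel_zero hy.2).add_const _).const_smul _

theorem hasFDerivAt_potential_reg (hn : 1 ≤ n) (hf : HasInvDecay f A) {ε : ℝ} (h0 : 0 < ε)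
    (h1 : ε ≤ 1) {x : Euc n} (hx : x ≠ 0) :
    HasFDerivAt (potential f ε) (regHessian f ε x) x := by
  refine hasFDerivAt_integral_of_dominated_of_fderiv_le
    (F' := fun x y => f y • kernelDeriv n ε (x - y)) (ball_mem_nhds x one_pos)
    (Eventually.of_forall fun x => aestronglyMeasurable_potential hf ε x)
    (integrable_potential hn hf h0.le h1 hx) (aestronglyMeasurable_smul_kernelDeriv hf h0 x) ?_
    ((integrable_majorant n).const_mul (A * ((n + 2) * ((1 + ε⁻¹) * (1 + (‖x‖ + 1))) ^ (n + 1)))) ?_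
  · filter_upwards [ae_ne_zero n] with y hy x' hx'
    refine norm_smul_kernelDeriv_le hn hf h0 ?_ hy
    rw [mem_ball_iff_norm] at hx'
    have := norm_sub_norm_le x' x
    linarith
  · refine Eventually.of_forall fun y x' _ => ?_
    have h := (hasFDerivAt_kernel h0 (x' - y)).comp x' ((hasFDerivAt_id x').sub_const y)
    exact (h.add_const (kernel n 1 y)).const_smul (f y)

theorem hasFDerivAt_potential (hn : 2 ≤ n) (hf : HasInvDecay f A) {x : Euc n} (hx : x ≠ 0) :
    HasFDerivAt (potential f 0) (gradConv f 0 x) x := by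
  have hs : IsOpen ({0}ᶜ : Set (Euc n)) := isOpen_compl_singleton
  refine hasFDerivAt_of_tendstoUniformlyOnFilter (l := 𝓝[>] (0 : ℝ)) (f := potential f)
    (f' := gradConv f) ?_ ?_ ?_
  · simpa [IsOpen.nhdsWithin_eq hs hx] using
      tendstoLocallyUniformlyOn_iff_filter.mp (tendstoLocallyUniformlyOn_gradConv hn hf) x hx
  · have e1 : ∀ᶠ ε in 𝓝[>] (0 : ℝ), ε ∈ Ioo (0 : ℝ) 1 := Ioo_mem_nhdsGT zero_lt_one
    have e2 : ∀ᶠ y in 𝓝 x, y ∈ ({0}ᶜ : Set (Euc n)) := hs.mem_nhds hx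
    filter_upwards [e1.prod_inl (𝓝 x), e2.prod_inr (𝓝[>] (0 : ℝ))] with p h1 h2
    rw [← regHessian_eq_gradConv hn hf h1.1 h2]
    exact hasFDerivAt_potential_reg (by omega) hf h1.1 h1.2.le h2
  · filter_upwards [hs.mem_nhds hx] with y hy
    exact tendsto_potential (by omega) hf hy

theorem inner_regHessian (hn : 1 ≤ n) (hf : HasInvDecay f A) {ε : ℝ} (hε : 0 < ε) (x a b : Euc n) :
    ⟪regHessian f ε x a, b⟫ = ∫ y, f y * ⟪kernelDeriv n ε (x - y) a, b⟫ := by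
  have i1 := integrable_smul_kernelDeriv hn hf hε x
  rw [regHessian, ContinuousLinearMap.integral_apply i1, real_inner_comm,
    ← integral_inner (i1.apply_continuousLinearMap a)]
  simp only [smul_apply, real_inner_comm _ b, inner_smul_left, RCLike.conj_to_real]

theorem integrable_mul_inner_kernelDeriv (hn : 1 ≤ n) (hf : HasInvDecay f A) {ε : ℝ} (hε : 0 < ε)
    (x a b : Euc n) : Integrable (fun y => f y * ⟪kernelDeriv n ε (x - y) a, b⟫) := by
  have i1 := ((integrable_smul_kernelDeriv hn hf hε x).apply_continuousLinearMap a)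
    |>.inner_const (𝕜 := ℝ) b
  simpa only [smul_apply, inner_smul_left, RCLike.conj_to_real] using i1

theorem inner_gradConv (hn : 2 ≤ n) (hf : HasInvDecay f A) {x : Euc n} (hx : x ≠ 0) (a b : Euc n) :
    ⟪gradConv f 0 x a, b⟫ = ∫ y, fderiv ℝ f y a * ⟪kernel n 0 (x - y), b⟫ := by
  have i1 := integrable_gradConv hn hf 0 hx
  rw [gradConv, ContinuousLinearMap.integral_apply i1, real_inner_comm,
    ← integral_inner (i1.apply_continuousLinearMap a)]
  simp only [ContinuousLinearMap.smulRight_apply, real_inner_comm _ b, inner_smul_left,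
    RCLike.conj_to_real]

theorem tendsto_inner_regHessian (hn : 2 ≤ n) (hf : HasInvDecay f A) {x : Euc n} (hx : x ≠ 0)
    (a b : Euc n) :
    Tendsto (fun ε => ⟪regHessian f ε x a, b⟫) (𝓝[>] 0) (𝓝 ⟪gradConv f 0 x a, b⟫) := by
  have h : Tendsto (fun ε => regHessian f ε x a) (𝓝[>] 0) (𝓝 (gradConv f 0 x a)) :=
    ((ContinuousLinearMap.apply ℝ (Euc n) a).continuous.tendsto _).comp
      (tendsto_regHessian hn hf hx)
  exact h.inner tendsto_const_nhds

theorem gradConv_symm (hn : 2 ≤ n) (hf : HasInvDecay f A) {x : Euc n} (hx : x ≠ 0) (a b : Euc n) :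
    ⟪gradConv f 0 x a, b⟫ = ⟪gradConv f 0 x b, a⟫ := by
  refine tendsto_nhds_unique (tendsto_inner_regHessian hn hf hx a b)
    ((tendsto_inner_regHessian hn hf hx b a).congr' ?_)
  filter_upwards [self_mem_nhdsWithin] with ε hε
  rw [inner_regHessian (by omega) hf hε, inner_regHessian (by omega) hf hε]
  simp only [kernelDeriv_symm ε _ a b]

theorem sum_gradConv (hn : 2 ≤ n) (hf : HasInvDecay f A) {x : Euc n} (hx : x ≠ 0) :
    ∑ k, ⟪gradConv f 0 x (EuclideanSpace.single k 1), EuclideanSpace.single k 1⟫ =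
      kernelMass n * f x := by
  refine tendsto_nhds_unique (tendsto_finsetSum _ fun k _ => tendsto_inner_regHessian hn hf hx _ _)
    ((tendsto_integral_kernelTrace (by omega) hf.lip.continuousOn hf.bound hx).congr' ?_)
  filter_upwards [self_mem_nhdsWithin] with ε hε
  simp only [inner_regHessian (by omega : 1 ≤ n) hf hε]
  rw [← integral_finsetSum _ fun k _ => integrable_mul_inner_kernelDeriv (by omega) hf hε x _ _]
  refine integral_congr_ae (Eventually.of_forall fun y => ?_)
  beta_reduce
  rw [← Finset.mul_sum, sum_kernelDeriv hε, mul_comm]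

theorem kernel_smul {t : ℝ} (ht : 0 < t) (ε : ℝ) (z : Euc n) :
    kernel n (t * ε) (t • z) = (t ^ n)⁻¹ • kernel n ε z := by
  rw [kernel, kernel, regLength_smul ht, smul_smul, smul_smul]
  congr 1
  rw [mul_pow, mul_inv, pow_succ]
  field_simp

/-- Radial averages of `f y • y` vanish when the first moments of `f` on the sphere do. -/
theorem integral_radial_smul_eq_zero {m : ℝ → ℝ}
    (hom : ∀ t : ℝ, 0 < t → ∀ y : Euc n, y ≠ 0 → f (t • y) = t⁻¹ * f y)
    (h0 : ∀ i : Fin (n + 1), ∫ x : sphere (0 : Euc n) 1, (x : Euc n) i * f x ∂(sphereMeasure n) = 0)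
    (hi : Integrable (fun y : Euc n => (f y * m ‖y‖) • y)) :
    ∫ y : Euc n, (f y * m ‖y‖) • y = 0 := by
  ext i
  have := (EuclideanSpace.proj (𝕜 := ℝ) i : Euc n →L[ℝ] ℝ).integral_comp_comm hi
  simp only [PiLp.proj_apply, PiLp.smul_apply, smul_eq_mul, PiLp.zero_apply] at this ⊢
  rw [← this, integral_polar_mul (fun ω => (ω : Euc n) i * f ω) (fun r => m r), h0 i, zero_mul]
  intro ω r hr
  have hω : ‖(ω : Euc n)‖ = 1 := by simp
  have hω' : (ω : Euc n) ≠ 0 := norm_ne_zero_iff.1 (by simp)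
  rw [hom r hr _ hω', norm_smul, hω, Real.norm_of_nonneg hr.le, mul_one, PiLp.smul_apply,
    smul_eq_mul]
  field_simp

theorem potential_smul (hn : 1 ≤ n) (hf : HasInvDecay f A)
    (hom : ∀ t : ℝ, 0 < t → ∀ y : Euc n, y ≠ 0 → f (t • y) = t⁻¹ * f y)
    (h0 : ∀ i : Fin (n + 1), ∫ x : sphere (0 : Euc n) 1, (x : Euc n) i * f x ∂(sphereMeasure n) = 0)
    {t : ℝ} (ht : 0 < t) {x : Euc n} (hx : x ≠ 0) :
    potential f 0 (t • x) = potential f 0 x := by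
  have htx : t • x ≠ 0 := smul_ne_zero ht.ne' hx
  have i1 := integrable_potential hn hf le_rfl zero_le_one hx
  have i2 := (integrable_potential hn hf le_rfl zero_le_one htx).comp_smul ht.ne'
  have i3 : Integrable fun y : Euc n => t ^ (n + 1) •
      (f (t • y) • (kernel n 0 (t • x - t • y) + kernel n 1 (t • y))) := i2.smul (t ^ (n + 1))
  have e1 : potential f 0 (t • x) = ∫ y : Euc n, t ^ (n + 1) •
      (f (t • y) • (kernel n 0 (t • x - t • y) + kernel n 1 (t • y))) := by
    rw [integral_smul, Measure.integral_comp_smul volume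
      (fun y => f y • (kernel n 0 (t • x - y) + kernel n 1 y))]
    simp only [finrank_euclideanSpace, Fintype.card_fin, potential]
    rw [smul_smul, abs_of_pos (by positivity), mul_inv_cancel₀ (by positivity), one_smul]
  have e2 : ∀ᵐ y : Euc n, t ^ (n + 1) •
      (f (t • y) • (kernel n 0 (t • x - t • y) + kernel n 1 (t • y))) -
      f y • (kernel n 0 (x - y) + kernel n 1 y) =
      (f y * (t ^ (n + 1) * (√((t * ‖y‖) ^ 2 + 1) ^ (n + 1))⁻¹ -
        (√(‖y‖ ^ 2 + 1) ^ (n + 1))⁻¹)) • y := by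
    filter_upwards [ae_ne_zero n] with y hy
    have k := kernel_smul (n := n) ht 0 (x - y)
    rw [mul_zero, smul_sub] at k
    have k1 (z : Euc n) : kernel n 1 z = (√(‖z‖ ^ 2 + 1) ^ (n + 1))⁻¹ • z := by
      simp [kernel, regLength]
    rw [k, hom t ht y hy, k1, k1, norm_smul, Real.norm_of_nonneg ht.le]
    simp only [smul_add, smul_smul]
    have c : t ^ (n + 1) * (t⁻¹ * f y * (t ^ n)⁻¹) = f y := by rw [pow_succ]; field_simp
    have c' : t ^ (n + 1) * (t⁻¹ * f y * ((√((t * ‖y‖) ^ 2 + 1) ^ (n + 1))⁻¹ * t)) =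
      f y * (t ^ (n + 1) * (√((t * ‖y‖) ^ 2 + 1) ^ (n + 1))⁻¹) := by field_simp
    rw [c, c', mul_sub, sub_smul]
    abel
  rw [← sub_eq_zero, e1, potential, ← integral_sub i3 i1, integral_congr_ae e2]
  exact integral_radial_smul_eq_zero (m := fun r => t ^ (n + 1) *
    (√((t * r) ^ 2 + 1) ^ (n + 1))⁻¹ - (√(r ^ 2 + 1) ^ (n + 1))⁻¹) hom h0
    ((i3.sub i1).congr e2)

end

/-- Functions that are `C²` and homogeneous of degree one away from the origin. -/
structure IsHomogeneousC2 {n : ℕ} (u : Euc n → ℝ) : Prop where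
  contDiffOn : ContDiffOn ℝ 2 u {0}ᶜ
  hom : ∀ t : ℝ, 0 < t → ∀ y : Euc n, y ≠ 0 → u (t • y) = t * u y

section
variable {n : ℕ}

theorem integral_fderiv_mul_kernelDeriv_comm (hn : 1 ≤ n) {h : Euc n → ℝ} {M : ℝ}
    (hh : LocallyLipschitzOn {0}ᶜ h) (hM0 : 0 ≤ M) (hM : ∀ y ≠ 0, |h y| ≤ M)
    (hM' : ∀ y ≠ 0, ‖fderiv ℝ h y‖ ≤ M * ‖y‖⁻¹) {ε : ℝ} (hε : 0 < ε) (x v w b : Euc n) :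
    ∫ y, fderiv ℝ h y w * ⟪kernelDeriv n ε (x - y) v, b⟫ =
      ∫ y, fderiv ℝ h y v * ⟪kernelDeriv n ε (x - y) w, b⟫ := by
  set D := (n + 2) * ((1 + ε⁻¹) * (1 + ‖x‖)) ^ (n + 1) with hD
  have hD0 : 0 ≤ D := by positivity
  set S := ‖v‖ + ‖w‖ + 1 with hS
  have hS1 : 1 ≤ S := by have := norm_nonneg v; have := norm_nonneg w; linarith
  have hle {a : Euc n} (ha : a = v ∨ a = w) : ‖a‖ ≤ S := by
    have := norm_nonneg v
    have := norm_nonneg w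
    rcases ha with rfl | rfl <;> linarith
  have key := integral_fderiv_mul_fderiv_comm (g := fun y => ⟪kernel n ε (x - y), b⟫) hh
    (contDiff_inner_kernel hε x b) v w (C := M * D * S ^ 2 * ‖b‖) ?_ ?_
  · simpa only [fderiv_inner_kernel hε, mul_neg, integral_neg, neg_inj] using key
  · intro y hy a c ha hc
    have m := inv_mul_inv_le_majorant (a := 1) (b := n + 1) hn (by omega) hy
    rw [abs_mul, fderiv_inner_kernel hε, abs_neg]
    calc _ ≤ (M * ‖y‖⁻¹ * S) * (D * (S * ‖b‖) * ((1 + ‖y‖) ^ (n + 1))⁻¹) := by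
          refine mul_le_mul ?_ ?_ (abs_nonneg _) (by positivity)
          · exact ((fderiv ℝ h y).le_opNorm a).trans
              (mul_le_mul (hM' y hy) (hle ha) (norm_nonneg _) (by positivity))
          · refine (abs_inner_kernelDeriv_le hε x c b y).trans ?_
            have := hle hc
            gcongr
      _ = M * D * S ^ 2 * ‖b‖ * ((‖y‖ ^ 1)⁻¹ * ((1 + ‖y‖) ^ (n + 1))⁻¹) := by rw [pow_one]; ring
      _ ≤ _ := by gcongr
  · intro y hy c hc
    have m := inv_mul_inv_le_majorant (a := 1) (b := n + 1) hn (by omega) hy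
    rw [abs_mul, fderiv_inner_kernel hε, abs_neg]
    calc _ ≤ (M * (D * (S * ‖b‖) * ((1 + ‖y‖) ^ (n + 1))⁻¹)) * ‖y‖⁻¹ := by
          refine mul_le_mul_of_nonneg_right (mul_le_mul (hM y hy) ?_ (abs_nonneg _) hM0)
            (by positivity)
          refine (abs_inner_kernelDeriv_le hε x c b y).trans ?_
          have := hle hc
          gcongr
      _ = M * D * S * ‖b‖ * ((‖y‖ ^ 1)⁻¹ * ((1 + ‖y‖) ^ (n + 1))⁻¹) := by rw [pow_one]; ring
      _ ≤ M * D * S ^ 2 * ‖b‖ * ((‖y‖ ^ 1)⁻¹ * ((1 + ‖y‖) ^ (n + 1))⁻¹) := by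
          gcongr
          nlinarith
      _ ≤ _ := by gcongr

theorem integrable_mul_inner_kernelDeriv_of_le (hn : 1 ≤ n) {g : Euc n → ℝ} {M : ℝ}
    (hg : AEStronglyMeasurable g volume) (hM : ∀ y ≠ 0, |g y| ≤ M * ‖y‖⁻¹) {ε : ℝ} (hε : 0 < ε)
    (x a b : Euc n) : Integrable (fun y => g y * ⟪kernelDeriv n ε (x - y) a, b⟫) := by
  set D := (n + 2) * ((1 + ε⁻¹) * (1 + ‖x‖)) ^ (n + 1) * (‖a‖ * ‖b‖) with hD
  have hc : Continuous fun y => ⟪kernelDeriv n ε (x - y) a, b⟫ :=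
    ((((continuous_kernelDeriv hε).comp (continuous_const.sub continuous_id)).clm_apply
      continuous_const).inner continuous_const)
  refine ((integrable_majorant n).const_mul (|M| * D)).mono' (hg.mul hc.aestronglyMeasurable) ?_
  filter_upwards [ae_ne_zero n] with y hy
  have m := inv_mul_inv_le_majorant (a := 1) (b := n + 1) hn (by omega) hy
  rw [Real.norm_eq_abs, abs_mul]
  calc _ ≤ (|M| * ‖y‖⁻¹) * (D * ((1 + ‖y‖) ^ (n + 1))⁻¹) := by
        refine mul_le_mul ((hM y hy).trans ?_) (abs_inner_kernelDeriv_le hε x a b y) (abs_nonneg _)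
          (by positivity)
        gcongr
        exact le_abs_self M
    _ = |M| * D * ((‖y‖ ^ 1)⁻¹ * ((1 + ‖y‖) ^ (n + 1))⁻¹) := by rw [pow_one]; ring
    _ ≤ _ := by gcongr

variable {u : Euc n → ℝ}

namespace IsHomogeneousC2

theorem contDiffAt (hu : IsHomogeneousC2 u) {y : Euc n} (hy : y ≠ 0) : ContDiffAt ℝ 2 u y :=
  hu.contDiffOn.contDiffAt (isOpen_compl_singleton.mem_nhds hy)

theorem contDiffOn_fderiv (hu : IsHomogeneousC2 u) : ContDiffOn ℝ 1 (fderiv ℝ u) {0}ᶜ :=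
  hu.contDiffOn.fderiv_of_isOpen isOpen_compl_singleton (by norm_num)

theorem hasFDerivAt (hu : IsHomogeneousC2 u) {y : Euc n} (hy : y ≠ 0) :
    HasFDerivAt u (fderiv ℝ u y) y :=
  ((hu.contDiffAt hy).differentiableAt (by norm_num)).hasFDerivAt

theorem hasFDerivAt_fderiv (hu : IsHomogeneousC2 u) {y : Euc n} (hy : y ≠ 0) :
    HasFDerivAt (fderiv ℝ u) (fderiv ℝ (fderiv ℝ u) y) y :=
  ((hu.contDiffOn_fderiv.contDiffAt (isOpen_compl_singleton.mem_nhds hy)).differentiableAt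
    (by norm_num)).hasFDerivAt

theorem continuousOn_hess (hu : IsHomogeneousC2 u) :
    ContinuousOn (fderiv ℝ (fderiv ℝ u)) {0}ᶜ :=
  hu.contDiffOn_fderiv.continuousOn_fderiv_of_isOpen isOpen_compl_singleton le_rfl

theorem fderiv_apply (hu : IsHomogeneousC2 u) {y : Euc n} (hy : y ≠ 0) (v w : Euc n) :
    fderiv ℝ (fun z => fderiv ℝ u z v) y w = fderiv ℝ (fderiv ℝ u) y w v := by
  have h := (hu.hasFDerivAt_fderiv hy).clm_apply (hasFDerivAt_const v y)
  rw [h.fderiv]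
  simp

theorem hess_symm (hu : IsHomogeneousC2 u) {y : Euc n} (hy : y ≠ 0) (v w : Euc n) :
    fderiv ℝ (fderiv ℝ u) y v w = fderiv ℝ (fderiv ℝ u) y w v :=
  ((hu.contDiffAt hy).isSymmSndFDerivAt (by simp)).eq v w

theorem fderiv_smul (hu : IsHomogeneousC2 u) {t : ℝ} (ht : 0 < t) {y : Euc n} (hy : y ≠ 0) :
    fderiv ℝ u (t • y) = fderiv ℝ u y := by
  have hty : t • y ≠ 0 := smul_ne_zero ht.ne' hy
  have h1 : HasFDerivAt (fun z => u (t • z)) (t • fderiv ℝ u (t • y)) y := by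
    have := (hu.hasFDerivAt hty).comp y ((hasFDerivAt_id y).const_smul t)
    refine this.congr_fderiv ?_
    ext v
    simp
  have h2 : HasFDerivAt (fun z => u (t • z)) (t • fderiv ℝ u y) y := by
    refine ((hu.hasFDerivAt hy).const_smul t).congr_of_eventuallyEq ?_
    filter_upwards [isOpen_compl_singleton.mem_nhds hy] with z hz
    simpa using hu.hom t ht z hz
  exact smul_right_injective _ ht.ne' (h1.unique h2)

theorem hess_smul (hu : IsHomogeneousC2 u) {t : ℝ} (ht : 0 < t) {y : Euc n} (hy : y ≠ 0) :
    fderiv ℝ (fderiv ℝ u) (t • y) = t⁻¹ • fderiv ℝ (fderiv ℝ u) y := by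
  have hty : t • y ≠ 0 := smul_ne_zero ht.ne' hy
  have h1 : HasFDerivAt (fun z => fderiv ℝ u (t • z)) (t • fderiv ℝ (fderiv ℝ u) (t • y)) y := by
    have := (hu.hasFDerivAt_fderiv hty).comp y ((hasFDerivAt_id y).const_smul t)
    refine this.congr_fderiv ?_
    ext v
    simp
  have h2 : HasFDerivAt (fun z => fderiv ℝ u (t • z)) (fderiv ℝ (fderiv ℝ u) y) y := by
    refine (hu.hasFDerivAt_fderiv hy).congr_of_eventuallyEq ?_
    filter_upwards [isOpen_compl_singleton.mem_nhds hy] with z hz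
    exact hu.fderiv_smul ht hz
  rw [← h1.unique h2, smul_smul, inv_mul_cancel₀ ht.ne', one_smul]

/-- Euler's identity. -/
theorem fderiv_self (hu : IsHomogeneousC2 u) {y : Euc n} (hy : y ≠ 0) : fderiv ℝ u y y = u y := by
  have h1 : HasDerivAt (fun t : ℝ => u (t • y)) (fderiv ℝ u y y) 1 := by
    have h := hu.hasFDerivAt hy
    rw [← one_smul ℝ y] at h
    have := h.comp_hasDerivAt (1 : ℝ) ((hasDerivAt_id (1 : ℝ)).smul_const y)
    exact this.congr_deriv (by simp)
  have h2 : HasDerivAt (fun t : ℝ => u (t • y)) (u y) 1 := by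
    have : HasDerivAt (fun t : ℝ => t * u y) (u y) 1 := by
      simpa using (hasDerivAt_id (1 : ℝ)).mul_const (u y)
    refine this.congr_of_eventuallyEq ?_
    filter_upwards [lt_mem_nhds (zero_lt_one' ℝ)] with t ht
    exact hu.hom t ht y hy
  exact h1.unique h2

set_option maxSynthPendingDepth 3 in
theorem exists_bounds (hu : IsHomogeneousC2 u) : ∃ M : ℝ, 0 ≤ M ∧
    (∀ y ≠ 0, ‖fderiv ℝ u y‖ ≤ M) ∧ ∀ y ≠ 0, ‖fderiv ℝ (fderiv ℝ u) y‖ ≤ M * ‖y‖⁻¹ := by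
  obtain ⟨M₁, h₁, b₁⟩ := exists_bound_of_homogeneous (g := fderiv ℝ u) (a := fun _ => 1)
    (fun _ _ => zero_le_one) hu.contDiffOn_fderiv.continuousOn
    (fun t ht y hy => by rw [hu.fderiv_smul ht hy, one_mul])
  obtain ⟨M₂, h₂, b₂⟩ := exists_bound_of_homogeneous (g := fderiv ℝ (fderiv ℝ u))
    (a := fun t => t⁻¹) (fun t ht => by positivity) hu.continuousOn_hess
    (fun t ht y hy => by
      rw [hu.hess_smul ht hy, norm_smul, Real.norm_of_nonneg (by positivity)])
  refine ⟨M₁ + M₂, by positivity, fun y hy => ?_, fun y hy => (b₂ y hy).trans ?_⟩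
  · linarith [b₁ y hy]
  · gcongr
    linarith

theorem locallyLipschitzOn_fderiv_apply (hu : IsHomogeneousC2 u) (v : Euc n) :
    LocallyLipschitzOn {0}ᶜ (fun y => fderiv ℝ u y v) := by
  intro y hy
  have h : ContDiffAt ℝ 1 (fun y => fderiv ℝ u y v) y :=
    (hu.contDiffOn_fderiv.contDiffAt (isOpen_compl_singleton.mem_nhds hy)).clm_apply
      contDiffAt_const
  obtain ⟨K, t, ht, hK⟩ := h.exists_lipschitzOnWith
  exact ⟨K, t, mem_nhdsWithin_of_mem_nhds ht, hK⟩

/-- Integrating by parts twice turns `f * ∂∂Φ` into `∂∂u * ΔΦ`. -/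
theorem inner_regHessian_eq (hu : IsHomogeneousC2 u) (hn : 1 ≤ n) {f : Euc n → ℝ} {A : ℝ}
    (hf : HasInvDecay f A) (hl : ∀ y ≠ 0, laplacian u y = f y) {ε : ℝ} (hε : 0 < ε)
    (x a b : Euc n) :
    ⟪regHessian f ε x a, b⟫ =
      ∫ y, kernelTrace n ε (x - y) * fderiv ℝ (fderiv ℝ u) y b a := by
  obtain ⟨M, hM, h1, h2⟩ := hu.exists_bounds
  have b1 (v : Euc n) : ∀ y ≠ 0, |fderiv ℝ u y v| ≤ M * ‖v‖ := fun y hy =>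
    ((fderiv ℝ u y).le_opNorm v).trans (by gcongr; exact h1 y hy)
  have b2 (v : Euc n) : ∀ y ≠ 0, ‖fderiv ℝ (fun z => fderiv ℝ u z v) y‖ ≤ M * ‖v‖ * ‖y‖⁻¹ := by
    intro y hy
    refine ContinuousLinearMap.opNorm_le_bound _ (by positivity) fun w => ?_
    rw [hu.fderiv_apply hy]
    refine ((fderiv ℝ (fderiv ℝ u) y).le_opNorm₂ w v).trans ?_
    have := h2 y hy
    calc _ ≤ M * ‖y‖⁻¹ * ‖w‖ * ‖v‖ := by gcongr
      _ = _ := by ring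
  have b3 (v w : Euc n) : ∀ y ≠ 0, |fderiv ℝ (fun z => fderiv ℝ u z v) y w| ≤
      M * ‖v‖ * ‖w‖ * ‖y‖⁻¹ := fun y hy => by
    refine (((fderiv ℝ (fun z => fderiv ℝ u z v) y)).le_opNorm w).trans ?_
    have := b2 v y hy
    calc _ ≤ M * ‖v‖ * ‖y‖⁻¹ * ‖w‖ := by gcongr
      _ = _ := by ring
  have int (v w a b : Euc n) : Integrable (fun y =>
      fderiv ℝ (fun z => fderiv ℝ u z v) y w * ⟪kernelDeriv n ε (x - y) a, b⟫) :=
    integrable_mul_inner_kernelDeriv_of_le hn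
      (measurable_fderiv_apply_const ℝ (fun z => fderiv ℝ u z v) w).aestronglyMeasurable
      (b3 v w) hε x a b
  have swap (p v w b : Euc n) := integral_fderiv_mul_kernelDeriv_comm hn
    (hu.locallyLipschitzOn_fderiv_apply p) (by positivity) (b1 p) (b2 p) hε x v w b
  have step (k : Fin (n + 1)) :
      ∫ y, fderiv ℝ (fun z => fderiv ℝ u z (EuclideanSpace.single k 1)) y
        (EuclideanSpace.single k 1) * ⟪kernelDeriv n ε (x - y) a, b⟫ =
      ∫ y, fderiv ℝ (fun z => fderiv ℝ u z a) y b *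
        ⟪kernelDeriv n ε (x - y) (EuclideanSpace.single k 1), EuclideanSpace.single k 1⟫ := by
    rw [swap, ← swap a]
    refine integral_congr_ae ?_
    filter_upwards [ae_ne_zero n] with y hy
    rw [hu.fderiv_apply hy, hu.fderiv_apply hy, hu.hess_symm hy, kernelDeriv_symm]
  calc ⟪regHessian f ε x a, b⟫ = ∫ y, f y * ⟪kernelDeriv n ε (x - y) a, b⟫ :=
        inner_regHessian hn hf hε x a b
    _ = ∫ y, ∑ k, fderiv ℝ (fun z => fderiv ℝ u z (EuclideanSpace.single k 1)) y
        (EuclideanSpace.single k 1) * ⟪kernelDeriv n ε (x - y) a, b⟫ := by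
        refine integral_congr_ae ?_
        filter_upwards [ae_ne_zero n] with y hy
        rw [← hl y hy, laplacian, Finset.sum_mul]
    _ = ∫ y, ∑ k, fderiv ℝ (fun z => fderiv ℝ u z a) y b *
        ⟪kernelDeriv n ε (x - y) (EuclideanSpace.single k 1), EuclideanSpace.single k 1⟫ := by
        rw [integral_finsetSum _ fun k _ => int _ _ _ _,
          integral_finsetSum _ fun k _ => int _ _ _ _]
        exact Finset.sum_congr rfl fun k _ => step k
    _ = _ := by
        refine integral_congr_ae ?_
        filter_upwards [ae_ne_zero n] with y hy
        rw [← Finset.mul_sum, sum_kernelDeriv hε, hu.fderiv_apply hy, mul_comm]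

/-- The Hessian of a solution is the singular integral of the gradient of the data. -/
theorem inner_gradConv_eq (hu : IsHomogeneousC2 u) (hn : 2 ≤ n) {f : Euc n → ℝ} {A : ℝ}
    (hf : HasInvDecay f A) (hl : ∀ y ≠ 0, laplacian u y = f y) {x : Euc n} (hx : x ≠ 0)
    (a b : Euc n) :
    ⟪gradConv f 0 x a, b⟫ = kernelMass n * fderiv ℝ (fderiv ℝ u) x b a := by
  obtain ⟨M, hM, -, h2⟩ := hu.exists_bounds
  have hc : ContinuousOn (fun y => fderiv ℝ (fderiv ℝ u) y b a) {0}ᶜ :=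
    (hu.continuousOn_hess.clm_apply continuousOn_const).clm_apply continuousOn_const
  have hb : ∀ y ≠ 0, |fderiv ℝ (fderiv ℝ u) y b a| ≤ M * ‖b‖ * ‖a‖ * ‖y‖⁻¹ := fun y hy => by
    refine ((fderiv ℝ (fderiv ℝ u) y).le_opNorm₂ b a).trans ?_
    have := h2 y hy
    calc _ ≤ M * ‖y‖⁻¹ * ‖b‖ * ‖a‖ := by gcongr
      _ = _ := by ring
  refine tendsto_nhds_unique (tendsto_inner_regHessian hn hf hx a b)
    ((tendsto_integral_kernelTrace (by omega) hc hb hx).congr' ?_)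
  filter_upwards [self_mem_nhdsWithin] with ε hε
  exact (hu.inner_regHessian_eq (by omega) hf hl hε x a b).symm

end IsHomogeneousC2

end

section
variable {n : ℕ}

theorem IsChristoffelSolution.isHomogeneousC2 {f u : Euc n → ℝ} (h : IsChristoffelSolution n f u) :
    IsHomogeneousC2 u := ⟨h.2.2.2.1, h.2.2.1⟩

theorem inner_gradConv_of_orthogonal (hn : 2 ≤ n) {f : Euc n → ℝ} {A : ℝ} (hf : HasInvDecay f A)
    {x ξ : Euc n} (hx : x ≠ 0) (h : ⟪ξ, x⟫ = 0) :
    ⟪gradConv f 0 x ξ, ξ⟫ = ∫ y, (-⟪ξ, y⟫ * fderiv ℝ f y ξ) / ‖x - y‖ ^ (n + 1) := by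
  rw [inner_gradConv hn hf hx]
  refine integral_congr_ae (Eventually.of_forall fun y => ?_)
  simp only [kernel, regLength_zero, inner_smul_left, RCLike.conj_to_real]
  rw [real_inner_comm, inner_sub_right, h]
  ring

/-- The affine line `t ↦ x + t • d`. -/
theorem hasDerivAt_line (x d : Euc n) (t : ℝ) : HasDerivAt (fun t : ℝ => x + t • d) d t := by
  simpa using ((hasDerivAt_id t).smul_const d).const_add x

theorem integrable_mul_of_compact {h φ : Euc n → ℝ} (hh : ContinuousOn h {0}ᶜ)
    (hφ : Continuous φ) (hc : HasCompactSupport φ) (h0 : (0 : Euc n) ∉ tsupport φ) :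
    Integrable (fun y => h y * φ y) := by
  have hsupp : Function.support (fun y => h y * φ y) ⊆ tsupport φ :=
    (Function.support_mul_subset_right _ _).trans (subset_tsupport φ)
  rw [← integrableOn_iff_integrable_of_support_subset hsupp]
  refine ContinuousOn.integrableOn_compact hc (ContinuousOn.mul (hh.mono ?_) hφ.continuousOn)
  rintro y hy rfl
  exact h0 hy

theorem sum_smul_single (y : Euc n) : ∑ k, y k • EuclideanSpace.single k (1 : ℝ) = y := by
  ext i
  simp [Pi.single_apply]

variable {u v : Euc n → ℝ}

namespace IsHomogeneousC2

theorem hasDerivAt_line (hu : IsHomogeneousC2 u) {x d : Euc n} {t : ℝ} (h : x + t • d ≠ 0) :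
    HasDerivAt (fun t : ℝ => u (x + t • d)) (fderiv ℝ u (x + t • d) d) t :=
  (hu.hasFDerivAt h).comp_hasDerivAt t (_root_.hasDerivAt_line x d t)

theorem hasDerivAt_fderiv_line (hu : IsHomogeneousC2 u) {x d : Euc n} {t : ℝ}
    (h : x + t • d ≠ 0) :
    HasDerivAt (fun t : ℝ => fderiv ℝ u (x + t • d) d)
      (fderiv ℝ (fderiv ℝ u) (x + t • d) d d) t := by
  have h1 := (hu.hasFDerivAt_fderiv h).comp_hasDerivAt t (_root_.hasDerivAt_line x d t)
  simpa using h1.clm_apply (hasDerivAt_const t d)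

theorem hess_nonneg_of_convexOn (hu : IsHomogeneousC2 u) (hc : ConvexOn ℝ univ u) {x ξ : Euc n}
    (hx : x ≠ 0) (h : ⟪ξ, x⟫ = 0) : 0 ≤ fderiv ℝ (fderiv ℝ u) x ξ ξ := by
  have hne (t : ℝ) : x + t • ξ ≠ 0 := by
    intro h0
    have : ⟪x + t • ξ, x⟫ = 0 := by rw [h0, inner_zero_left]
    rw [inner_add_left, inner_smul_left, h, mul_zero, add_zero] at this
    exact hx (inner_self_eq_zero.1 this)
  have hφ : ConvexOn ℝ univ (fun t : ℝ => u (x + t • ξ)) := by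
    have := hc.comp_affineMap (AffineMap.lineMap x (x + ξ))
    simpa [Function.comp_def, AffineMap.lineMap_apply, add_comm] using this
  have hd : deriv (fun t : ℝ => u (x + t • ξ)) = fun t => fderiv ℝ u (x + t • ξ) ξ :=
    funext fun t => (hu.hasDerivAt_line (hne t)).deriv
  have hm := hφ.monotoneOn_deriv fun t _ => (hu.hasDerivAt_line (hne t)).differentiableAt
  rw [hd, monotoneOn_univ] at hm
  have h2 := hm.deriv_nonneg (x := 0)
  rwa [(hu.hasDerivAt_fderiv_line (hne 0)).deriv, zero_smul, add_zero] at h2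

theorem convexOn_of_hess_nonneg (hu : IsHomogeneousC2 u) (hn : 2 ≤ n) (hc : Continuous u)
    (h : ∀ x ≠ 0, ∀ ξ, 0 ≤ fderiv ℝ (fderiv ℝ u) x ξ ξ) : ConvexOn ℝ univ u := by
  refine ⟨convex_univ, fun x _ y _ a b ha hb hab => ?_⟩
  have hspan : Submodule.span ℝ {x, y} ≠ ⊤ := by
    intro htop
    have h1 := finrank_span_finset_le_card (R := ℝ) ({x, y} : Finset (Euc n))
    have h2 := Finset.card_le_two (a := x) (b := y)
    rw [Set.finrank, Finset.coe_pair, htop, finrank_top, finrank_euclideanSpace,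
      Fintype.card_fin] at h1
    omega
  obtain ⟨w, -, hw⟩ := SetLike.exists_of_lt hspan.lt_top
  have key (s : ℝ) (hs : s ≠ 0) :
      u (a • (x + s • w) + b • (y + s • w)) ≤ a * u (x + s • w) + b * u (y + s • w) := by
    set d := y - x with hd
    have hne (t : ℝ) : x + s • w + t • d ≠ 0 := by
      intro h0
      refine hw ((Submodule.smul_mem_iff _ hs).1 ?_)
      have : s • w = (t - 1) • x + (-t) • y := by
        rw [← sub_eq_zero, ← h0, hd]; module
      rw [this]
      exact add_mem (Submodule.smul_mem _ _ (Submodule.subset_span (by simp)))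
        (Submodule.smul_mem _ _ (Submodule.subset_span (by simp)))
    have hder : deriv (fun t : ℝ => u (x + s • w + t • d)) =
        fun t => fderiv ℝ u (x + s • w + t • d) d :=
      funext fun t => (hu.hasDerivAt_line (hne t)).deriv
    have hφ : ConvexOn ℝ univ (fun t : ℝ => u (x + s • w + t • d)) := by
      refine convexOn_univ_of_deriv2_nonneg
        (fun t => (hu.hasDerivAt_line (hne t)).differentiableAt) ?_ fun t => ?_
      · rw [hder]
        exact fun t => (hu.hasDerivAt_fderiv_line (hne t)).differentiableAt
      · rw [Function.iterate_succ, Function.iterate_one, Function.comp_apply, hder,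
          (hu.hasDerivAt_fderiv_line (hne t)).deriv]
        exact h _ (hne t) d
    have := hφ.2 (mem_univ 0) (mem_univ 1) ha hb hab
    have e1 : a • (x + s • w) + b • (y + s • w) = x + s • w + (a • (0 : ℝ) + b • (1 : ℝ)) • d := by
      have ha' : a = 1 - b := by linarith
      rw [ha', hd]
      simp only [smul_eq_mul, mul_zero, mul_one, zero_add]
      module
    have e2 : y + s • w = x + s • w + (1 : ℝ) • d := by rw [hd]; module
    rw [e1, e2]
    simpa using this
  have t1 : Continuous fun s : ℝ => u (a • (x + s • w) + b • (y + s • w)) := by fun_prop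
  have t2 : Continuous fun s : ℝ => a * u (x + s • w) + b * u (y + s • w) := by fun_prop
  have := le_of_tendsto_of_tendsto
    ((t1.tendsto 0).mono_left (nhdsWithin_le_nhds (s := {0}ᶜ)))
    ((t2.tendsto 0).mono_left nhdsWithin_le_nhds)
    (by filter_upwards [self_mem_nhdsWithin] with s hs using key s hs)
  simpa using this

theorem exists_eq_add_inner (hu : IsHomogeneousC2 u) (hv : IsHomogeneousC2 v) (hn : 2 ≤ n)
    (hcu : Continuous u) (hcv : Continuous v)
    (h : ∀ x ≠ 0, fderiv ℝ (fderiv ℝ u) x = fderiv ℝ (fderiv ℝ v) x) :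
    ∃ a : Euc n, ∀ x, u x = v x + ⟪a, x⟫ := by
  have hrank : 1 < Module.rank ℝ (Euc n) := by
    rw [rank_eq_card_basis (EuclideanSpace.basisFun (Fin (n + 1)) ℝ).toBasis]
    simp only [Fintype.card_fin]
    exact_mod_cast (by omega : 1 < n + 1)
  obtain ⟨L, hL⟩ := isOpen_compl_singleton.exists_eq_add_of_fderiv_eq
    (isConnected_compl_singleton_of_one_lt_rank hrank (0 : Euc n)).isPreconnected
    (fun x hx => (hu.hasFDerivAt_fderiv hx).differentiableAt.differentiableWithinAt)
    (fun x hx => (hv.hasFDerivAt_fderiv hx).differentiableAt.differentiableWithinAt)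
    (fun x hx => h x hx)
  set a := (InnerProductSpace.toDual ℝ (Euc n)).symm L with ha
  have hne : ∀ x ≠ 0, u x = v x + ⟪a, x⟫ := fun x hx => by
    rw [← hu.fderiv_self hx, ← hv.fderiv_self hx, hL hx, ha, InnerProductSpace.toDual_symm_apply]
    simp
  refine ⟨a, fun x => ?_⟩
  have hd : Dense ({0}ᶜ : Set (Euc n)) := dense_compl_singleton 0
  exact congr_fun (hcu.ext_on hd (by fun_prop : Continuous fun x => v x + ⟪a, x⟫)
    (fun x hx => hne x hx)) x

theorem continuousOn (hu : IsHomogeneousC2 u) : ContinuousOn u {0}ᶜ := hu.contDiffOn.continuousOn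

theorem integral_coord_mul_laplacian (hu : IsHomogeneousC2 u) (i : Fin (n + 1)) (j : ℕ) :
    ∫ y : Euc n, laplacian u y * (y i * radialCutoff n j y) = 0 := by
  set χ := radialCutoff n j with hχ
  have cχ : ContDiff ℝ 1 χ := contDiff_radialCutoff n j
  have hs : tsupport (fun y : Euc n => y i * χ y) ⊆ tsupport χ := tsupport_mul_subset_right
  have cφ : ContDiff ℝ 1 fun y : Euc n => y i * χ y :=
    (EuclideanSpace.proj (𝕜 := ℝ) i : Euc n →L[ℝ] ℝ).contDiff.mul cχ
  have sφ : HasCompactSupport fun y : Euc n => y i * χ y :=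
    (hasCompactSupport_radialCutoff n j).mul_left
  have zφ : (0 : Euc n) ∉ tsupport fun y : Euc n => y i * χ y :=
    fun h => zero_notMem_tsupport_radialCutoff n j (hs h)
  have dφ (y w : Euc n) : fderiv ℝ (fun y : Euc n => y i * χ y) y w =
      w i * χ y + y i * (deriv (cutoffProfile j) (‖y‖ ^ 2) * (2 * ⟪y, w⟫)) := by
    have h1 := (EuclideanSpace.proj (𝕜 := ℝ) i : Euc n →L[ℝ] ℝ).hasFDerivAt (x := y)
    have h2 := ((cχ.differentiable (by simp)) y).hasFDerivAt
    have h3 := (h1.mul h2).fderiv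
    have h4 : fderiv ℝ (fun y : Euc n => y i * χ y) y = _ := h3
    rw [h4, ← fderiv_radialCutoff]
    simp only [add_apply, smul_apply, smul_eq_mul, PiLp.proj_apply]
    ring
  have cu' (k : Fin (n + 1)) : ContinuousOn
      (fun y => fderiv ℝ (fun z => fderiv ℝ u z (EuclideanSpace.single k 1)) y
        (EuclideanSpace.single k 1)) {0}ᶜ :=
    ((hu.continuousOn_hess.clm_apply continuousOn_const).clm_apply continuousOn_const).congr
      fun y hy => hu.fderiv_apply hy _ _
  have lu : LocallyLipschitzOn {0}ᶜ u := by
    intro y hy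
    obtain ⟨K, t, ht, hK⟩ := ((hu.contDiffAt hy).of_le (by norm_num)).exists_lipschitzOnWith
    exact ⟨K, t, mem_nhdsWithin_of_mem_nhds ht, hK⟩
  have e1 := integral_fderiv_mul_eq_neg lu cχ (hasCompactSupport_radialCutoff n j)
    (zero_notMem_tsupport_radialCutoff n j) (EuclideanSpace.single i 1)
  have cfu : ContinuousOn (fun y => fderiv ℝ u y (EuclideanSpace.single i 1)) {0}ᶜ :=
    (hu.locallyLipschitzOn_fderiv_apply _).continuousOn
  have i1 := integrable_mul_of_compact cfu cχ.continuous (hasCompactSupport_radialCutoff n j)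
    (zero_notMem_tsupport_radialCutoff n j)
  have i2 := integrable_mul_fderiv_of_compact hu.continuousOn cχ
    (hasCompactSupport_radialCutoff n j) (zero_notMem_tsupport_radialCutoff n j)
    (EuclideanSpace.single i 1)
  calc ∫ y : Euc n, laplacian u y * (y i * χ y)
      = ∑ k, ∫ y, fderiv ℝ (fun z => fderiv ℝ u z (EuclideanSpace.single k 1)) y
        (EuclideanSpace.single k 1) * (y i * χ y) := by
        rw [← integral_finsetSum _ fun k _ => integrable_mul_of_compact (cu' k) cφ.continuous sφ zφ]
        simp only [laplacian, Finset.sum_mul]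
    _ = -∫ y, ∑ k, fderiv ℝ u y (EuclideanSpace.single k 1) *
        fderiv ℝ (fun y : Euc n => y i * χ y) y (EuclideanSpace.single k 1) := by
        rw [integral_finsetSum _ fun k _ => integrable_mul_fderiv_of_compact
          (hu.locallyLipschitzOn_fderiv_apply _).continuousOn cφ sφ zφ _, ← Finset.sum_neg_distrib]
        exact Finset.sum_congr rfl fun k _ => integral_fderiv_mul_eq_neg
          (hu.locallyLipschitzOn_fderiv_apply _) cφ sφ zφ _
    _ = -∫ y, (fderiv ℝ u y (EuclideanSpace.single i 1) * χ y +
        u y * fderiv ℝ χ y (EuclideanSpace.single i 1)) := by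
        congr 1
        refine integral_congr_ae ?_
        filter_upwards [ae_ne_zero n] with y hy
        have eu : ∑ k, y k * fderiv ℝ u y (EuclideanSpace.single k 1) = u y := by
          rw [← hu.fderiv_self hy]
          nth_rewrite 4 [← sum_smul_single y]
          simp only [map_sum, map_smul, smul_eq_mul]
        have ei : ∑ k, fderiv ℝ u y (EuclideanSpace.single k 1) *
            (EuclideanSpace.single k (1 : ℝ) : Euc n) i =
            fderiv ℝ u y (EuclideanSpace.single i 1) := by
          simp
        have hin (k : Fin (n + 1)) : ⟪y, EuclideanSpace.single k (1 : ℝ)⟫ = y k := by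
          simp [EuclideanSpace.inner_single_right]
        rw [hχ, fderiv_radialCutoff, ← hχ, hin, ← eu, ← ei, Finset.sum_mul, Finset.sum_mul,
          ← Finset.sum_add_distrib]
        refine Finset.sum_congr rfl fun k _ => ?_
        rw [dφ, hin]
        ring
    _ = 0 := by rw [integral_add i1 i2, e1, neg_add_cancel, neg_zero]

/-- The data of a solution has vanishing first moments on the sphere. -/
theorem integral_sphere_coord_eq_zero (hu : IsHomogeneousC2 u) {f : Euc n → ℝ}
    (hl : ∀ y ≠ 0, laplacian u y = f y)
    (hom : ∀ t : ℝ, 0 < t → ∀ y : Euc n, y ≠ 0 → f (t • y) = t⁻¹ * f y) (i : Fin (n + 1)) :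
    ∫ x : sphere (0 : Euc n) 1, (x : Euc n) i * f x ∂(sphereMeasure n) = 0 := by
  have h0 := hu.integral_coord_mul_laplacian i 0
  have hω (ω : sphere (0 : Euc n) 1) : (ω : Euc n) ≠ 0 := norm_ne_zero_iff.1 (by simp)
  have hr (ω : sphere (0 : Euc n) 1) {r : ℝ} (hr : 0 < r) :
      radialCutoff n 0 (r • (ω : Euc n)) = cutoffProfile 0 (r ^ 2) := by
    rw [radialCutoff, norm_smul, Real.norm_of_nonneg hr.le, norm_eq_of_mem_sphere, mul_one]
  rw [integral_polar_mul (fun ω => (ω : Euc n) i * f ω) (fun r => cutoffProfile 0 (r ^ 2))] at h0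
  · have hpos : 0 < ∫ y, radialCutoff n 0 y :=
      (contDiff_radialCutoff n 0).continuous.integral_pos_of_hasCompactSupport_nonneg_nonzero
        (hasCompactSupport_radialCutoff n 0) (fun y => cutoffProfile_nonneg _ _)
        (x := EuclideanSpace.single 0 1) (by simp [radialCutoff, cutoffProfile_one])
    rw [integral_polar_mul (fun _ => 1) (fun r => cutoffProfile 0 (r ^ 2)) _
      fun ω r h => by rw [hr ω h, one_mul]] at hpos
    exact (mul_eq_zero.1 h0).resolve_right (right_ne_zero_of_mul hpos.ne')
  · intro ω r h
    rw [hl _ (smul_ne_zero h.ne' (hω ω)), hom r h _ (hω ω), hr ω h, PiLp.smul_apply, smul_eq_mul]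
    field_simp

end IsHomogeneousC2

end

section
variable {n : ℕ} {f : Euc n → ℝ} {A : ℝ}

/-- The candidate solution of the Christoffel problem with data `f`. -/
noncomputable def supportPotential (f : Euc n → ℝ) (x : Euc n) : ℝ :=
  (kernelMass n)⁻¹ * ⟪x, potential f 0 x⟫

theorem gradConv_self (hn : 2 ≤ n) (hf : HasInvDecay f A)
    (hP : ∀ t : ℝ, 0 < t → ∀ x : Euc n, x ≠ 0 → potential f 0 (t • x) = potential f 0 x)
    {x : Euc n} (hx : x ≠ 0) : gradConv f 0 x x = 0 := by
  have h1 : HasDerivAt (fun t : ℝ => t • x) x 1 := by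
    simpa using (hasDerivAt_id (1 : ℝ)).smul_const x
  have h2 : HasFDerivAt (potential f 0) (gradConv f 0 x) ((1 : ℝ) • x) := by
    rw [one_smul]
    exact hasFDerivAt_potential hn hf hx
  refine (h2.comp_hasDerivAt 1 h1).unique
    ((hasDerivAt_const 1 (potential f 0 x)).congr_of_eventuallyEq ?_)
  filter_upwards [lt_mem_nhds one_pos] with t ht using hP t ht x hx

theorem hasFDerivAt_supportPotential (hn : 2 ≤ n) (hf : HasInvDecay f A)
    (hP : ∀ t : ℝ, 0 < t → ∀ x : Euc n, x ≠ 0 → potential f 0 (t • x) = potential f 0 x)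
    {x : Euc n} (hx : x ≠ 0) :
    HasFDerivAt (supportPotential f) ((kernelMass n)⁻¹ • innerSL ℝ (potential f 0 x)) x := by
  have h := ((hasFDerivAt_id x).inner ℝ (hasFDerivAt_potential hn hf hx)).const_mul
    (kernelMass n)⁻¹
  refine h.congr_fderiv ?_
  ext v
  have e : ⟪x, gradConv f 0 x v⟫ = 0 := by
    rw [real_inner_comm, gradConv_symm hn hf hx, gradConv_self hn hf hP hx, inner_zero_left]
  simp [fderivInnerCLM_apply, e, real_inner_comm]

theorem hasFDerivAt_fderiv_supportPotential (hn : 2 ≤ n) (hf : HasInvDecay f A)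
    (hP : ∀ t : ℝ, 0 < t → ∀ x : Euc n, x ≠ 0 → potential f 0 (t • x) = potential f 0 x)
    {x : Euc n} (hx : x ≠ 0) :
    HasFDerivAt (fderiv ℝ (supportPotential f))
      ((kernelMass n)⁻¹ • (innerSL ℝ).comp (gradConv f 0 x)) x := by
  have h := ((innerSL ℝ (E := Euc n)).hasFDerivAt.comp x
    (hasFDerivAt_potential hn hf hx)).const_smul (kernelMass n)⁻¹
  refine HasFDerivAt.congr_of_eventuallyEq h ?_
  filter_upwards [isOpen_compl_singleton.mem_nhds hx] with y hy
  exact (hasFDerivAt_supportPotential hn hf hP hy).fderiv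

theorem isHomogeneousC2_supportPotential (hn : 2 ≤ n) (hf : HasInvDecay f A)
    (hP : ∀ t : ℝ, 0 < t → ∀ x : Euc n, x ≠ 0 → potential f 0 (t • x) = potential f 0 x) :
    IsHomogeneousC2 (supportPotential f) := by
  refine ⟨?_, fun t ht y hy => ?_⟩
  · have hP1 : ContDiffOn ℝ 1 (potential f 0) {0}ᶜ := by
      rw [show (1 : WithTop ℕ∞) = 0 + 1 by norm_num,
        contDiffOn_succ_iff_fderiv_of_isOpen isOpen_compl_singleton]
      refine ⟨fun x hx => (hasFDerivAt_potential hn hf hx).differentiableAt.differentiableWithinAt,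
        by simp, contDiffOn_zero.2 <| (continuousOn_gradConv hn hf).congr fun x hx =>
          (hasFDerivAt_potential hn hf hx).fderiv⟩
    rw [show (2 : WithTop ℕ∞) = 1 + 1 by norm_num,
      contDiffOn_succ_iff_fderiv_of_isOpen isOpen_compl_singleton]
    refine ⟨fun x hx =>
      (hasFDerivAt_supportPotential hn hf hP hx).differentiableAt.differentiableWithinAt,
      by simp, ?_⟩
    refine ContDiffOn.congr (f := fun x => (kernelMass n)⁻¹ • innerSL ℝ (potential f 0 x)) ?_
      fun x hx => (hasFDerivAt_supportPotential hn hf hP hx).fderiv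
    exact ((innerSL ℝ (E := Euc n)).contDiff.comp_contDiffOn hP1).const_smul _
  · rw [supportPotential, supportPotential, hP t ht y hy, real_inner_smul_left]
    ring

theorem continuous_supportPotential (hn : 2 ≤ n) (hf : HasInvDecay f A)
    (hP : ∀ t : ℝ, 0 < t → ∀ x : Euc n, x ≠ 0 → potential f 0 (t • x) = potential f 0 x) :
    Continuous (supportPotential f) := by
  rw [continuous_iff_continuousAt]
  intro x
  rcases eq_or_ne x 0 with rfl | hx
  swap
  · exact (hasFDerivAt_supportPotential hn hf hP hx).continuousAt
  obtain ⟨M, hM, hb⟩ := exists_bound_of_homogeneous (g := supportPotential f) (a := fun t => t)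
    (fun t ht => ht.le) (fun x hx =>
      (hasFDerivAt_supportPotential hn hf hP hx).continuousAt.continuousWithinAt)
    fun t ht y hy => by
      rw [(isHomogeneousC2_supportPotential hn hf hP).hom t ht y hy, norm_mul,
        Real.norm_of_nonneg ht.le]
  have e0 : supportPotential f 0 = 0 := by simp [supportPotential]
  rw [ContinuousAt, e0]
  refine squeeze_zero_norm (a := fun y => M * ‖y‖) (fun y => ?_) ?_
  · rcases eq_or_ne y 0 with rfl | hy
    · simp [e0]
    · exact hb y hy
  · have : Continuous fun y : Euc n => M * ‖y‖ := by fun_prop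
    simpa using this.tendsto 0

theorem hess_supportPotential (hn : 2 ≤ n) (hf : HasInvDecay f A)
    (hP : ∀ t : ℝ, 0 < t → ∀ x : Euc n, x ≠ 0 → potential f 0 (t • x) = potential f 0 x)
    {x : Euc n} (hx : x ≠ 0) (a b : Euc n) :
    fderiv ℝ (fderiv ℝ (supportPotential f)) x a b =
      (kernelMass n)⁻¹ * ⟪gradConv f 0 x a, b⟫ := by
  rw [(hasFDerivAt_fderiv_supportPotential hn hf hP hx).fderiv]
  simp

theorem laplacian_supportPotential (hn : 2 ≤ n) (hf : HasInvDecay f A)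
    (hP : ∀ t : ℝ, 0 < t → ∀ x : Euc n, x ≠ 0 → potential f 0 (t • x) = potential f 0 x)
    {x : Euc n} (hx : x ≠ 0) : laplacian (supportPotential f) x = f x := by
  simp only [laplacian, (isHomogeneousC2_supportPotential hn hf hP).fderiv_apply hx,
    hess_supportPotential hn hf hP hx]
  rw [← Finset.mul_sum, sum_gradConv hn hf hx, inv_mul_cancel_left₀ (kernelMass_pos n).ne']

theorem hess_supportPotential_nonneg (hn : 2 ≤ n) (hf : HasInvDecay f A)
    (hP : ∀ t : ℝ, 0 < t → ∀ x : Euc n, x ≠ 0 → potential f 0 (t • x) = potential f 0 x)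
    (h : ∀ x ∈ sphere (0 : Euc n) 1, ∀ ξ : Euc n, ‖ξ‖ = 1 → ⟪ξ, x⟫ = 0 →
      0 ≤ ∫ y, (-⟪ξ, y⟫ * fderiv ℝ f y ξ) / ‖x - y‖ ^ (n + 1))
    {x : Euc n} (hx : x ≠ 0) (ξ : Euc n) :
    0 ≤ fderiv ℝ (fderiv ℝ (supportPotential f)) x ξ ξ := by
  wlog hx1 : ‖x‖ = 1 generalizing x
  · have h1 := (isHomogeneousC2_supportPotential hn hf hP).hess_smul
      (inv_pos.2 (norm_pos_iff.2 hx)) hx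
    have h2 := this (smul_ne_zero (inv_ne_zero (norm_ne_zero_iff.2 hx)) hx)
      (by rw [norm_smul, norm_inv, norm_norm, inv_mul_cancel₀ (norm_ne_zero_iff.2 hx)])
    rw [h1, inv_inv, smul_apply, smul_apply, smul_eq_mul] at h2
    exact nonneg_of_mul_nonneg_right h2 (norm_pos_iff.2 hx)
  rw [hess_supportPotential hn hf hP hx]
  refine mul_nonneg (inv_nonneg.2 (kernelMass_pos n).le) ?_
  set η := ξ - ⟪ξ, x⟫ • x with hη
  have hηx : ⟪η, x⟫ = 0 := by
    rw [hη, inner_sub_left, real_inner_smul_left, real_inner_self_eq_norm_sq, hx1]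
    ring
  have hξ : ξ = η + ⟪ξ, x⟫ • x := by rw [hη]; module
  have h0 := gradConv_self hn hf hP hx
  have e : ⟪gradConv f 0 x ξ, ξ⟫ = ⟪gradConv f 0 x η, η⟫ := by
    rw [hξ, map_add, map_smul, h0, smul_zero, add_zero, inner_add_right, real_inner_smul_right,
      gradConv_symm hn hf hx η x, h0, inner_zero_left, mul_zero, add_zero]
  rw [e]
  rcases eq_or_ne η 0 with h' | h'
  · rw [h', inner_zero_right]
  have hn' : ‖η‖ ≠ 0 := norm_ne_zero_iff.2 h'
  have h1 : ‖‖η‖⁻¹ • η‖ = 1 := by rw [norm_smul, norm_inv, norm_norm, inv_mul_cancel₀ hn']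
  have h2 : ⟪‖η‖⁻¹ • η, x⟫ = 0 := by rw [real_inner_smul_left, hηx, mul_zero]
  have h3 := h x (by simpa using hx1) _ h1 h2
  rw [← inner_gradConv_of_orthogonal hn hf hx h2, map_smul, real_inner_smul_left,
    real_inner_smul_right, ← mul_assoc] at h3
  exact nonneg_of_mul_nonneg_right h3 (by positivity)

end

/-- solvability of the Christoffel problem. -/
theorem stmt_1 (n : ℕ) (hn : 2 ≤ n)
    (f : EuclideanSpace ℝ (Fin (n + 1)) → ℝ) (K : NNReal)
    (hf_pos : ∀ x ∈ sphere (0 : EuclideanSpace ℝ (Fin (n + 1))) 1, 0 < f x)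
    (hf_lip : LipschitzOnWith K f (sphere (0 : EuclideanSpace ℝ (Fin (n + 1))) 1))
    (hf_hom : ∀ t : ℝ, 0 < t → ∀ y : EuclideanSpace ℝ (Fin (n + 1)), y ≠ 0 →
      f (t • y) = t⁻¹ * f y) :
    ((∃ u : EuclideanSpace ℝ (Fin (n + 1)) → ℝ, IsChristoffelSolution n f u) ↔
      ((∀ i : Fin (n + 1),
          ∫ x : sphere (0 : EuclideanSpace ℝ (Fin (n + 1))) 1,
            (x : EuclideanSpace ℝ (Fin (n + 1))) i * f x ∂(sphereMeasure n) = 0) ∧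
        (∀ x ∈ sphere (0 : EuclideanSpace ℝ (Fin (n + 1))) 1,
          ∀ ξ : EuclideanSpace ℝ (Fin (n + 1)), ‖ξ‖ = 1 → ⟪ξ, x⟫ = 0 →
            0 ≤ ∫ y : EuclideanSpace ℝ (Fin (n + 1)),
              (-⟪ξ, y⟫ * fderiv ℝ f y ξ) / ‖x - y‖ ^ (n + 1))))
    ∧ (∀ u v : EuclideanSpace ℝ (Fin (n + 1)) → ℝ,
        IsChristoffelSolution n f u → IsChristoffelSolution n f v →
          ∃ a : EuclideanSpace ℝ (Fin (n + 1)), ∀ x, u x = v x + ⟪a, x⟫) := by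
  obtain ⟨A, hf⟩ := exists_hasInvDecay hf_lip hf_hom
  refine ⟨⟨?_, ?_⟩, ?_⟩
  · rintro ⟨u, h⟩
    have hu := h.isHomogeneousC2
    refine ⟨hu.integral_sphere_coord_eq_zero h.2.2.2.2 hf_hom, fun x hx ξ _ hξ => ?_⟩
    have hx0 : x ≠ 0 := by
      rintro rfl
      simp at hx
    rw [← inner_gradConv_of_orthogonal hn hf hx0 hξ, hu.inner_gradConv_eq hn hf h.2.2.2.2 hx0]
    exact mul_nonneg (kernelMass_pos n).le (hu.hess_nonneg_of_convexOn h.2.1 hx0 hξ)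
  · rintro ⟨h0, h⟩
    have hP : ∀ t : ℝ, 0 < t → ∀ x : EuclideanSpace ℝ (Fin (n + 1)), x ≠ 0 →
        potential f 0 (t • x) = potential f 0 x :=
      fun t ht x hx => potential_smul (by omega) hf hf_hom h0 ht hx
    have hu := isHomogeneousC2_supportPotential hn hf hP
    have hc := continuous_supportPotential hn hf hP
    exact ⟨supportPotential f, hc, hu.convexOn_of_hess_nonneg hn hc
      fun x hx ξ => hess_supportPotential_nonneg hn hf hP h hx ξ, hu.hom, hu.contDiffOn,
      fun x hx => laplacian_supportPotential hn hf hP hx⟩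
  · intro u v hu hv
    refine hu.isHomogeneousC2.exists_eq_add_inner hv.isHomogeneousC2 hn hu.1 hv.1 fun x hx => ?_
    ext a b
    have e1 := hu.isHomogeneousC2.inner_gradConv_eq hn hf hu.2.2.2.2 hx b a
    rw [hv.isHomogeneousC2.inner_gradConv_eq hn hf hv.2.2.2.2 hx b a] at e1
    exact (mul_left_cancel₀ (kernelMass_pos n).ne' e1).symm
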